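/- arXiv:2511.01637 — 2 statements merged into one kernel-verified Lean document; each statement's English description precedes it below -/
import Mathlib

section
/- Let m ≥ 1, let f : ℂ^m → ℂ be a nonconstant entire function that never takes the value 0 (this is a sufficient condition for the paper's hypothesis N̄_{2)}(r,0;f) = o(T(r,f)), since then f has no zeros at all), let u ∈ ℂ^m be a unit vector, and let k, n be positive integers with n ≥ k such that ∂_u^k(f^n) is not identically zero. If f^n and ∂_u^k(f^n) share the value 1 IM, then there exists c ∈ ℂ \ {0} with (c/n)^k = 1 such that f = c·∂_u f identically on ℂ^m. (Paper's Corollary 2.1, specialized to the zero-free case.) -/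
/-- The directional derivative of `f : ℂ^m → ℂ` along the direction `u`. -/
noncomputable def dirDeriv {m : ℕ} (u : Fin m → ℂ) (f : (Fin m → ℂ) → ℂ) :
    (Fin m → ℂ) → ℂ :=
  fun z => fderiv ℂ f z u

open Complex Metric Set Filter Topology

/-- An entire function is Lipschitz on every closed ball. -/
lemma Differentiable.exists_lipschitzOnWith_closedBall {E F : Type*} [NormedAddCommGroup E]
    [NormedSpace ℂ E] [ProperSpace E] [NormedAddCommGroup F] [NormedSpace ℂ F]
    {f : E → F} (hf : Differentiable ℂ f) (c : E) (R : ℝ) :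
    ∃ C : NNReal, LipschitzOnWith C f (closedBall c R) := by
  obtain ⟨B, hB⟩ := (isCompact_closedBall c (R + 1)).exists_bound_of_continuousOn
    hf.continuous.continuousOn
  let _ : NormedSpace ℝ E := NormedSpace.restrictScalars ℝ ℂ E
  refine ⟨Real.toNNReal (2 * B), Convex.lipschitzOnWith_of_nnnorm_fderiv_le (𝕜 := ℂ)
    (fun x _ => hf x) (fun x hx => ?_) (convex_closedBall c R)⟩
  have h1 : closedBall x 1 ⊆ closedBall c (R + 1) :=
    closedBall_subset_closedBall' (by linarith [mem_closedBall.1 hx])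
  have h2 : ‖fderiv ℂ f x‖ ≤ 2 * B / 1 := by
    refine Complex.norm_fderiv_le_div_of_mapsTo_ball hf.differentiableOn (fun y hy => ?_) one_pos
    rw [mem_closedBall, dist_eq_norm]
    have := hB y (h1 (ball_subset_closedBall hy))
    have := hB x (h1 (mem_closedBall_self zero_le_one))
    linarith [norm_sub_le (f y) (f x)]
  rw [← NNReal.coe_le_coe, coe_nnnorm]
  exact (h2.trans_eq (div_one _)).trans (Real.le_coe_toNNReal _)

lemma hasDerivAt_comp_line {m : ℕ} (u : Fin m → ℂ) {f : (Fin m → ℂ) → ℂ}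
    (hf : Differentiable ℂ f) (z : Fin m → ℂ) (t : ℂ) :
    HasDerivAt (fun s : ℂ => f (z + s • u)) (dirDeriv u f (z + t • u)) t := by
  have h : HasDerivAt (fun s : ℂ => z + s • u) ((1 : ℂ) • u) t :=
    ((hasDerivAt_id t).smul_const u).const_add z
  rw [one_smul] at h
  exact (hf (z + t • u)).hasFDerivAt.comp_hasDerivAt t h

/-- The directional derivatives of an entire function of several variables are entire. -/
lemma differentiable_dirDeriv {m : ℕ} (u : Fin m → ℂ) {f : (Fin m → ℂ) → ℂ}
    (hf : Differentiable ℂ f) : Differentiable ℂ (dirDeriv u f) := by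
  have hcauchy : dirDeriv u f = fun z => (2 * Real.pi * I : ℂ)⁻¹ •
      ∫ θ in (0 : ℝ)..2 * Real.pi, deriv (circleMap 0 1) θ •
        (((circleMap 0 1 θ - 0) ^ 2)⁻¹ • f (z + circleMap 0 1 θ • u)) := by
    funext z
    have hd : Differentiable ℂ (fun s : ℂ => f (z + s • u)) := fun t =>
      (hasDerivAt_comp_line u hf z t).differentiableAt
    have h := two_pi_I_inv_smul_circleIntegral_sub_sq_inv_smul_of_differentiable
      (c := 0) (w₀ := 0) (R := 1) isOpen_univ (subset_univ _) hd.differentiableOn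
      (mem_ball_self one_pos)
    rw [(hasDerivAt_comp_line u hf z 0).deriv] at h
    simpa [circleIntegral] using h.symm
  rw [hcauchy]
  intro z₀
  refine DifferentiableAt.const_smul ?_ (2 * Real.pi * I : ℂ)⁻¹
  obtain ⟨C, hC⟩ := hf.exists_lipschitzOnWith_closedBall z₀ (1 + ‖u‖)
  have hmem : ∀ x ∈ closedBall z₀ 1, ∀ θ : ℝ,
      x + circleMap 0 1 θ • u ∈ closedBall z₀ (1 + ‖u‖) := by
    intro x hx θ
    rw [mem_closedBall, dist_eq_norm] at *
    calc ‖x + circleMap 0 1 θ • u - z₀‖ = ‖(x - z₀) + circleMap 0 1 θ • u‖ := by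
          congr 1; abel
      _ ≤ ‖x - z₀‖ + ‖circleMap 0 1 θ • u‖ := norm_add_le _ _
      _ ≤ 1 + ‖u‖ := by
          rw [norm_smul]
          simp only [norm_circleMap_zero, abs_one, one_mul]
          linarith
  have hk : Continuous fun θ : ℝ => deriv (circleMap 0 1) θ * ((circleMap 0 1 θ - 0) ^ 2)⁻¹ := by
    simp only [deriv_circleMap]
    refine Continuous.mul (by fun_prop) (Continuous.inv₀ (by fun_prop) fun θ => ?_)
    simp [circleMap]
  have hcont : ∀ x, Continuous fun θ : ℝ => deriv (circleMap 0 1) θ •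
        (((circleMap 0 1 θ - 0) ^ 2)⁻¹ • f (x + circleMap 0 1 θ • u)) := by
    intro x
    have := hf.continuous
    simp only [smul_eq_mul, ← mul_assoc]
    exact hk.mul (by fun_prop)
  refine (intervalIntegral.hasFDerivAt_integral_of_dominated_loc_of_lip (𝕜 := ℂ)
    (bound := fun _ => (C : ℝ))
    (F' := fun θ => (deriv (circleMap 0 1) θ * ((circleMap 0 1 θ - 0) ^ 2)⁻¹) •
      fderiv ℂ f (z₀ + circleMap 0 1 θ • u))
    (closedBall_mem_nhds z₀ one_pos) (.of_forall fun x => (hcont x).aestronglyMeasurable)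
    ((hcont z₀).intervalIntegrable _ _) ?_ ?_ intervalIntegrable_const ?_).2.differentiableAt
  · have hm : Measurable fun θ : ℝ => fderiv ℂ f (z₀ + circleMap 0 1 θ • u) :=
      (measurable_fderiv ℂ f).comp (Continuous.measurable (by fun_prop))
    exact (hk.measurable.smul hm).aestronglyMeasurable
  · refine .of_forall fun θ _ => LipschitzOnWith.of_dist_le_mul fun x hx y hy => ?_
    have := hC.dist_le_mul _ (hmem x hx θ) _ (hmem y hy θ)
    simpa [dist_eq_norm, ← mul_sub, norm_mul] using this
  · refine .of_forall fun θ _ => ?_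
    have h : HasFDerivAt (fun x => f (x + circleMap 0 1 θ • u))
        (fderiv ℂ f (z₀ + circleMap 0 1 θ • u)) z₀ :=
      (hasFDerivAt_comp_add_right _).2 (hf _).hasFDerivAt
    simpa [Pi.smul_def, mul_assoc] using
      h.const_smul (deriv (circleMap 0 1) θ * ((circleMap 0 1 θ - 0) ^ 2)⁻¹)

lemma differentiable_iterate_dirDeriv {m : ℕ} (u : Fin m → ℂ) {f : (Fin m → ℂ) → ℂ}
    (hf : Differentiable ℂ f) (k : ℕ) : Differentiable ℂ ((dirDeriv u)^[k] f) :=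
  Function.Iterate.rec (fun g => Differentiable ℂ g)
    hf (fun _ hg => differentiable_dirDeriv u hg) k

lemma iteratedDeriv_comp_line {m : ℕ} (u : Fin m → ℂ) {f : (Fin m → ℂ) → ℂ}
    (hf : Differentiable ℂ f) (z : Fin m → ℂ) (k : ℕ) (t : ℂ) :
    iteratedDeriv k (fun s : ℂ => f (z + s • u)) t = (dirDeriv u)^[k] f (z + t • u) := by
  induction k generalizing t with
  | zero => simp
  | succ k ih =>
    rw [iteratedDeriv_succ, funext ih, Function.iterate_succ_apply',
      (hasDerivAt_comp_line u (differentiable_iterate_dirDeriv u hf k) z t).deriv]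

/-- A boundary Harnack estimate: if `re G` is positive on the ball around `z` whose boundary
contains a zero `ζ` of `re G`, then `deriv G z` is controlled by `deriv G ζ`. -/
lemma norm_deriv_le_of_re_pos_of_re_eq_zero {G : ℂ → ℂ} (hG : Differentiable ℂ G) {z ζ : ℂ}
    (hne : z ≠ ζ) (hpos : ∀ w ∈ ball z (dist ζ z), 0 < (G w).re) (hζ : (G ζ).re = 0) :
    ‖deriv G z‖ ≤ 4 * ‖deriv G ζ‖ := by
  set R := dist ζ z with hR
  have hR0 : 0 < R := dist_pos.2 hne.symm
  set v := (G z).re with hv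
  have hv0 : 0 < v := hpos z (mem_ball_self hR0)
  set W : ℂ → ℂ := fun w => (G w - G z) / (G w + (starRingEnd ℂ) (G z)) with hW
  have hden : ∀ w ∈ ball z R, G w + (starRingEnd ℂ) (G z) ≠ 0 := fun w hw h => by
    have := congrArg Complex.re h
    simp only [add_re, conj_re, zero_re] at this
    linarith [hpos w hw]
  have hWz : W z = 0 := by simp [hW]
  have hdiff : DifferentiableOn ℂ W (ball z R) := fun w hw =>
    (((hG w).sub_const _).div ((hG w).add_const _) (hden w hw)).differentiableWithinAt
  have hsq : ∀ w, ‖G w - G z‖ ^ 2 = ((G w).re - v) ^ 2 + ((G w).im - (G z).im) ^ 2 := fun w => by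
    rw [← normSq_eq_norm_sq, normSq_apply]; simp; ring
  have hsq' : ∀ w, ‖G w + (starRingEnd ℂ) (G z)‖ ^ 2 =
      ((G w).re + v) ^ 2 + ((G w).im - (G z).im) ^ 2 := fun w => by
    rw [← normSq_eq_norm_sq, normSq_apply]; simp; ring
  have hmaps : MapsTo W (ball z R) (closedBall (W z) 1) := fun w hw => by
    rw [hWz, mem_closedBall_zero_iff, norm_div, div_le_one (norm_pos_iff.2 (hden w hw))]
    refine le_of_sq_le_sq ?_ (norm_nonneg _)
    rw [hsq, hsq']
    nlinarith [hpos w hw]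
  have hinner : ‖deriv G z‖ ≤ 2 * v / R := by
    have h := Complex.norm_deriv_le_div_of_mapsTo_ball hdiff hmaps hR0
    have hd : HasDerivAt W (deriv G z / (2 * v : ℝ)) z := by
      have hz : G z + (starRingEnd ℂ) (G z) = (2 * v : ℝ) := by rw [add_conj]
      have := ((hG z).hasDerivAt.sub_const (G z)).div
        ((hG z).hasDerivAt.add_const ((starRingEnd ℂ) (G z))) (hden z (mem_ball_self hR0))
      rw [hz] at this
      refine this.congr_deriv ?_
      have : ((2 * v : ℝ) : ℂ) ≠ 0 := by exact_mod_cast (by positivity : (2 * v : ℝ) ≠ 0)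
      field_simp
      ring
    rw [hd.deriv, norm_div, norm_real, Real.norm_of_nonneg (by positivity),
      div_le_div_iff₀ (by positivity) hR0] at h
    rw [le_div_iff₀ hR0]
    linarith
  have hharnack : ∀ w ∈ ball z R, v * (1 - dist w z / R) / 2 ≤ (G w).re := fun w hw => by
    have h := Complex.dist_le_div_mul_dist_of_mapsTo_ball hdiff hmaps hw
    rw [hWz, dist_zero_right, norm_div, div_le_iff₀ (norm_pos_iff.2 (hden w hw))] at h
    set q := 1 / R * dist w z with hq
    have hq0 : 0 ≤ q := by positivity
    have hq1 : q < 1 := by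
      rw [hq, one_div_mul_eq_div, div_lt_one hR0]; exact hw
    have h2 : ‖G w - G z‖ ^ 2 ≤ (q * ‖G w + (starRingEnd ℂ) (G z)‖) ^ 2 :=
      pow_le_pow_left₀ (norm_nonneg _) h 2
    rw [mul_pow, hsq, hsq'] at h2
    have hx := hpos w hw
    have h3 : v - (G w).re ≤ q * ((G w).re + v) := by
      refine abs_le_of_sq_le_sq' ?_ (by positivity) |>.2
      have : q ^ 2 ≤ 1 := by nlinarith
      nlinarith [sq_nonneg ((G w).im - (G z).im)]
    have : dist w z / R = q := by rw [hq, one_div_mul_eq_div]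
    rw [this]
    nlinarith
  have houter : v / 2 ≤ ‖deriv G ζ‖ * R := by
    have hline : HasDerivAt (fun s : ℝ => z + (s : ℂ) * (ζ - z)) (ζ - z) 1 := by
      simpa using ((ofRealCLM.hasDerivAt (x := (1 : ℝ))).mul_const (ζ - z)).const_add z
    have hcomp : HasDerivAt (fun s : ℝ => (G (z + (s : ℂ) * (ζ - z))).re)
        (deriv G ζ * (ζ - z)).re 1 := by
      have h1 : HasDerivAt G (deriv G ζ) (z + ((1 : ℝ) : ℂ) * (ζ - z)) := by
        simpa using (hG ζ).hasDerivAt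
      exact reCLM.hasFDerivAt.comp_hasDerivAt (1 : ℝ) (h1.comp (1 : ℝ) hline)
    have hslope := (hasDerivAt_iff_tendsto_slope_left_right.1 hcomp).1
    have hle : (deriv G ζ * (ζ - z)).re ≤ -(v / 2) := by
      refine le_of_tendsto hslope ?_
      filter_upwards [Ioo_mem_nhdsLT (zero_lt_one (α := ℝ))] with s hs
      have hd : dist (z + (s : ℂ) * (ζ - z)) z = s * R := by
        rw [dist_eq_norm, add_sub_cancel_left, norm_mul, norm_real,
          Real.norm_of_nonneg hs.1.le, hR, dist_eq_norm]
      have := hharnack (z + (s : ℂ) * (ζ - z)) (by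
        rw [mem_ball, hd]; nlinarith [hs.2])
      rw [hd, mul_div_cancel_right₀ _ hR0.ne'] at this
      rw [slope_def_field]
      simp only [ofReal_one, one_mul, add_sub_cancel, hζ, sub_zero]
      rw [div_le_iff_of_neg (by linarith [hs.2])]
      linarith
    calc v / 2 ≤ -(deriv G ζ * (ζ - z)).re := by linarith
      _ ≤ ‖deriv G ζ * (ζ - z)‖ := (neg_le_abs _).trans (abs_re_le_norm _)
      _ = ‖deriv G ζ‖ * R := by rw [norm_mul, hR, dist_eq_norm]
  calc ‖deriv G z‖ ≤ 2 * v / R := hinner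
    _ ≤ 4 * ‖deriv G ζ‖ := by rw [div_le_iff₀ hR0]; linarith

/-- A bound for `deriv G` on the zeros of `re G` in a ball centred at such a zero propagates to
the whole concentric ball of half the radius. -/
lemma norm_deriv_le_of_forall_re_eq_zero {G : ℂ → ℂ} (hG : Differentiable ℂ G) {z₀ : ℂ}
    (hz₀ : (G z₀).re = 0) {M r : ℝ}
    (hM : ∀ ζ ∈ closedBall z₀ (2 * r), (G ζ).re = 0 → ‖deriv G ζ‖ ≤ M) {z : ℂ}
    (hz : z ∈ closedBall z₀ r) : ‖deriv G z‖ ≤ 4 * M := by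
  have hr : 0 ≤ r := dist_nonneg.trans hz
  have hclosed : IsClosed {w | (G w).re = 0} :=
    isClosed_eq (continuous_re.comp hG.continuous) continuous_const
  obtain ⟨ζ, hζ, hdist⟩ := hclosed.exists_infDist_eq_dist ⟨z₀, hz₀⟩ z
  have hmin : dist z ζ ≤ dist z z₀ := hdist ▸ infDist_le_dist_of_mem hz₀
  have hζM : ‖deriv G ζ‖ ≤ M := by
    refine hM ζ ?_ hζ
    have := dist_triangle ζ z z₀
    rw [mem_closedBall] at *
    rw [dist_comm ζ z] at this
    linarith
  have hzero : ∀ w ∈ ball z (dist ζ z), (G w).re ≠ 0 := fun w hw h => by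
    have h1 : infDist z {w | (G w).re = 0} ≤ dist z w := infDist_le_dist_of_mem h
    rw [mem_ball, dist_comm w, dist_comm ζ] at hw
    linarith
  by_cases hne : z = ζ
  · subst hne
    linarith [norm_nonneg (deriv G z)]
  have hmem : z ∈ ball z (dist ζ z) := mem_ball_self (dist_pos.2 (Ne.symm hne))
  have hsign : ∀ H : ℂ → ℂ, Differentiable ℂ H → (∀ w ∈ ball z (dist ζ z), (H w).re ≠ 0) →
      0 < (H z).re → ∀ w ∈ ball z (dist ζ z), 0 < (H w).re := by
    intro H hH hH0 hHz w hw
    by_contra hcon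
    obtain ⟨y, hy, hy0⟩ := (convex_ball z (dist ζ z)).isPreconnected.intermediate_value hw hmem
      (continuous_re.comp hH.continuous).continuousOn ⟨not_lt.1 hcon, hHz.le⟩
    exact hH0 y hy hy0
  rcases lt_or_gt_of_ne (hzero z hmem) with h | h
  · have := norm_deriv_le_of_re_pos_of_re_eq_zero hG.neg hne
      (hsign _ hG.neg (fun w hw => by simpa using hzero w hw) (by simpa using h))
      (by simpa using hζ)
    simp only [norm_neg, Pi.neg_def, deriv.fun_neg] at this
    linarith
  · linarith [norm_deriv_le_of_re_pos_of_re_eq_zero hG hne (hsign _ hG hzero h) hζ]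

/-- If `H` is close enough to an affine map with slope of modulus one and `re (H 0) = 0`, then
`exp ∘ H` takes the value `1` at a point where its `k`-th derivative is not small. -/
lemma exists_exp_eq_one_le_norm_iteratedDeriv (k : ℕ) :
    ∃ ρ : ℝ, 0 < ρ ∧ ∀ H : ℂ → ℂ, Differentiable ℂ H → ‖deriv H 0‖ = 1 → (H 0).re = 0 →
      (∀ s ∈ closedBall (0 : ℂ) ρ, ‖deriv H s‖ ≤ 8) →
      ∃ s, exp (H s) = 1 ∧ 1 / 2 ≤ ‖iteratedDeriv k (fun t => exp (H t)) s‖ := by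
  have hfact : (1 : ℝ) ≤ k.factorial := by exact_mod_cast k.factorial_pos
  set δ : ℝ := 1 / (12 * k.factorial) with hδ
  have hδ0 : 0 < δ := by positivity
  have hδ1 : δ ≤ 1 / 12 := by
    rw [hδ]; gcongr; linarith
  refine ⟨272 / δ, by positivity, fun H hH ha hre hbd => ?_⟩
  set a := deriv H 0 with hadef
  have hρ : 272 < 272 / δ := by rw [lt_div_iff₀ hδ0]; linarith
  have hslope : ∀ s ∈ closedBall (0 : ℂ) 17, ‖deriv H s - a‖ ≤ δ := fun s hs => by
    rw [mem_closedBall, dist_zero_right] at hs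
    have hmaps : MapsTo (deriv H) (ball 0 (272 / δ)) (closedBall (deriv H 0) 16) := fun w hw => by
      rw [mem_closedBall, dist_eq_norm]
      linarith [norm_sub_le (deriv H w) (deriv H 0), hbd w (ball_subset_closedBall hw)]
    have h := Complex.dist_le_div_mul_dist_of_mapsTo_ball (z := s)
      hH.deriv.differentiableOn hmaps (by rw [mem_ball, dist_zero_right]; linarith)
    rw [dist_eq_norm, dist_zero_right] at h
    calc ‖deriv H s - a‖ ≤ 16 / (272 / δ) * ‖s‖ := h
      _ ≤ 16 / (272 / δ) * 17 := by gcongr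
      _ = δ := by field_simp; norm_num
  set E : ℂ → ℂ := fun s => H s - a * s with hE
  have hlip : ∀ s ∈ closedBall (0 : ℂ) 17, ∀ t ∈ closedBall (0 : ℂ) 17,
      ‖E t - E s‖ ≤ δ * ‖t - s‖ := fun s hs t ht => by
    have hd : ∀ w, HasDerivAt E (deriv H w - a) w := fun w => by
      exact ((hH w).hasDerivAt.sub ((hasDerivAt_id w).const_mul a)).congr_deriv (by rw [mul_one])
    exact Convex.norm_image_sub_le_of_norm_deriv_le (fun w _ => (hd w).differentiableAt)
      (fun w hw => (hd w).deriv ▸ hslope w hw) (convex_closedBall _ _) hs ht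
  have himage : ball (H 0) (14 / 2) ⊆ H '' closedBall 0 16 := by
    refine hH.diffContOnCl.ball_subset_image_closedBall (by norm_num) (fun s hs => ?_) ?_
    · rw [mem_sphere, dist_zero_right] at hs
      have h1 := hlip 0 (by simp) s (by rw [mem_closedBall, dist_zero_right]; linarith)
      have h2 : a * s = (H s - H 0) - (E s - E 0) := by simp [hE]
      have h3 : ‖a * s‖ = 16 := by rw [norm_mul, ha, hs, one_mul]
      rw [h2] at h3
      rw [sub_zero, hs] at h1
      linarith [norm_sub_le (H s - H 0) (E s - E 0)]
    · have : deriv H 0 ≠ 0 := fun h => by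
        rw [hadef, h, norm_zero] at ha
        exact zero_ne_one ha
      exact ((hH 0).hasDerivAt.eventually_ne this).frequently.filter_mono nhdsWithin_le_nhds
  obtain ⟨n, hn⟩ : ∃ n : ℤ, (n : ℂ) * (2 * Real.pi * I) ∈ ball (H 0) (14 / 2) := by
    refine ⟨round ((H 0).im / (2 * Real.pi)), ?_⟩
    have hπ := Real.pi_pos
    have h0 : H 0 = ((H 0).im : ℂ) * I := by
      apply Complex.ext <;> simp [hre]
    rw [mem_ball, dist_comm, dist_eq_norm]
    have h1 := abs_sub_round ((H 0).im / (2 * Real.pi))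
    set j := round ((H 0).im / (2 * Real.pi))
    have h2 : H 0 - j * (2 * Real.pi * I) =
        (((H 0).im / (2 * Real.pi) - j) * (2 * Real.pi) : ℝ) * I := by
      rw [h0, mul_I_im, ofReal_re]
      push_cast
      have : (Real.pi : ℂ) ≠ 0 := by exact_mod_cast hπ.ne'
      field_simp
    rw [h2, norm_mul, norm_I, mul_one, norm_real, norm_mul, Real.norm_eq_abs,
      Real.norm_of_nonneg (by positivity)]
    nlinarith [Real.pi_lt_four]
  obtain ⟨s, hs, hHs⟩ := himage hn
  rw [mem_closedBall, dist_zero_right] at hs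
  have hexp : exp (H s) = 1 := hHs ▸ exp_eq_one_iff.2 ⟨n, rfl⟩
  refine ⟨s, hexp, ?_⟩
  set L : ℂ → ℂ := fun t => exp (a * (t - s)) with hL
  have hLd : Differentiable ℂ L := by fun_prop
  have hKd : Differentiable ℂ fun t => exp (H t) := hH.cexp
  have hLk : ‖iteratedDeriv k L s‖ = 1 := by
    have h : iteratedDeriv k L s = a ^ k := by
      have := congrFun (iteratedDeriv_comp_sub_const k (fun t => exp (a * t)) s) s
      rw [iteratedDeriv_cexp_const_mul] at this
      simpa using this
    rw [h, norm_pow, ha, one_pow]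
  have hdiff : ‖iteratedDeriv k ((fun t => exp (H t)) - L) s‖ ≤ 1 / 2 := by
    have h := Complex.norm_iteratedDeriv_le_of_forall_mem_sphere_norm_le (C := 6 * δ) (c := s) k
      one_pos (hKd.sub hLd).diffContOnCl (fun t ht => ?_)
    · refine h.trans_eq ?_
      rw [hδ, one_pow]
      field_simp
      norm_num
    · rw [mem_sphere, dist_eq_norm] at ht
      have hl := hlip s (by rw [mem_closedBall, dist_zero_right]; linarith) t (by
        rw [mem_closedBall, dist_zero_right]
        linarith [norm_add_le (t - s) s, congrArg norm (sub_add_cancel t s)])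
      rw [ht, mul_one] at hl
      have hfac : exp (H t) - L t = L t * (exp (E t - E s) - 1) := by
        have : H t = a * (t - s) + (E t - E s) + H s := by simp only [hE]; ring
        rw [this, exp_add, exp_add, hexp]
        ring
      have hLt : ‖L t‖ ≤ 3 := by
        refine (norm_exp_le_exp_norm _).trans ?_
        rw [norm_mul, ha, ht, one_mul]
        linarith [Real.exp_one_lt_d9]
      have he := Complex.norm_exp_sub_one_le (x := E t - E s) (by linarith)
      rw [Pi.sub_apply, hfac, norm_mul]
      calc ‖L t‖ * ‖exp (E t - E s) - 1‖ ≤ 3 * (2 * δ) := by gcongr; linarith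
        _ = 6 * δ := by ring
  rw [iteratedDeriv_sub (hKd.contDiff.contDiffAt) (hLd.contDiff.contDiffAt)] at hdiff
  have := norm_sub_norm_le (iteratedDeriv k L s) (iteratedDeriv k (fun t => exp (H t)) s)
  rw [norm_sub_rev] at this
  linarith

/-- An entire `G` whose derivative is bounded on `re G = 0` is affine. -/
lemma deriv_eq_deriv_of_bounded_on_re_eq_zero {G : ℂ → ℂ} (hG : Differentiable ℂ G) {M : ℝ}
    (hM : ∀ ζ, (G ζ).re = 0 → ‖deriv G ζ‖ ≤ M) (z w : ℂ) : deriv G z = deriv G w := by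
  by_cases hzero : ∃ z₀, (G z₀).re = 0
  · obtain ⟨z₀, hz₀⟩ := hzero
    refine hG.deriv.apply_eq_apply_of_bounded
      (isBounded_iff_forall_norm_le.2 ⟨4 * M, ?_⟩) z w
    rintro _ ⟨x, rfl⟩
    exact norm_deriv_le_of_forall_re_eq_zero hG hz₀ (fun ζ _ => hM ζ) (r := dist x z₀)
      (mem_closedBall.2 le_rfl)
  · have hconst : ∀ H : ℂ → ℂ, Differentiable ℂ H → (∀ x, (H x).re < 0) → ∀ x, deriv H x = 0 := by
      intro H hH hneg
      have hb : Bornology.IsBounded (range fun x => exp (H x)) := by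
        refine isBounded_iff_forall_norm_le.2 ⟨1, ?_⟩
        rintro _ ⟨x, rfl⟩
        simpa [norm_exp] using (hneg x).le
      intro x
      have h1 : HasDerivAt (fun x => exp (H x)) (exp (H x) * deriv H x) x :=
        (hH x).hasDerivAt.cexp
      have h2 : (fun x => exp (H x)) = fun _ => exp (H 0) :=
        funext fun y => hH.cexp.apply_eq_apply_of_bounded hb y 0
      rw [h2] at h1
      simpa [exp_ne_zero] using h1.unique (hasDerivAt_const x _)
    push Not at hzero
    have hall : (∀ x, (G x).re < 0) ∨ ∀ x, 0 < (G x).re := by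
      by_contra! hcon
      obtain ⟨⟨x, hx⟩, y, hy⟩ := hcon
      obtain ⟨c, -, hc⟩ := isPreconnected_univ.intermediate_value (mem_univ y) (mem_univ x)
        (continuous_re.comp hG.continuous).continuousOn ⟨hy, hx⟩
      exact hzero c hc
    rcases hall with h | h
    · rw [hconst G hG h, hconst G hG h]
    · have h' := hconst (fun x => -G x) hG.neg (fun x => by simpa using h x)
      simp only [deriv.fun_neg, neg_eq_zero] at h'
      rw [h', h']

/-- If `exp ∘ G = 1` implies `(exp ∘ G)⁽ᵏ⁾ = 1` with `k ≥ 1`, then the entire function `G` is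
affine. -/
lemma deriv_eq_deriv_of_exp_eq_one_imp {G : ℂ → ℂ} (hG : Differentiable ℂ G) {k : ℕ} (hk : 1 ≤ k)
    (hshare : ∀ z, exp (G z) = 1 → iteratedDeriv k (fun t => exp (G t)) z = 1) (z w : ℂ) :
    deriv G z = deriv G w := by
  obtain ⟨ρ, hρ, hmain⟩ := exists_exp_eq_one_le_norm_iteratedDeriv k
  refine deriv_eq_deriv_of_bounded_on_re_eq_zero hG (M := 2 * ρ + 2) (fun ζ hζ => ?_) z w
  by_contra! hlarge
  have hclosed : IsClosed {w | (G w).re = 0} :=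
    isClosed_eq (continuous_re.comp hG.continuous) continuous_const
  have : CompleteSpace {w | (G w).re = 0} := hclosed.completeSpace_coe
  obtain ⟨ε, hε, ⟨x, hx⟩, hε1, -, hlow, hup⟩ := hofer (⟨ζ, hζ⟩ : {w | (G w).re = 0}) 1 one_pos
    (ϕ := fun y => ‖deriv G y‖)
    ((hG.deriv.continuous.norm).comp continuous_subtype_val) (fun _ => norm_nonneg _)
  simp only [one_mul, Subtype.forall, Subtype.dist_eq, mem_ofPred_eq] at hlow hup hx
  set M := ‖deriv G x‖ with hMdef
  have hM2 : 2 * ρ + 2 < M := by nlinarith [norm_nonneg (deriv G x)]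
  have hM0 : 0 < M := by linarith
  have hbd : ∀ y ∈ closedBall x (ε / 2), ‖deriv G y‖ ≤ 4 * (2 * M) := fun y hy =>
    norm_deriv_le_of_forall_re_eq_zero hG hx (fun ξ hξ hξ0 => hup ξ hξ0 (by
      rw [dist_comm]; linarith [mem_closedBall.1 hξ])) hy
  have hd : ∀ s : ℂ, HasDerivAt (fun s : ℂ => G (x + (M : ℂ)⁻¹ * s))
      (deriv G (x + (M : ℂ)⁻¹ * s) * (M : ℂ)⁻¹) s := fun s => by
    have h := ((hasDerivAt_id s).const_mul (M : ℂ)⁻¹).const_add x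
    rw [mul_one] at h
    exact (hG _).hasDerivAt.comp s h
  obtain ⟨s, hs1, hs2⟩ := hmain (fun s => G (x + (M : ℂ)⁻¹ * s))
    (fun s => (hd s).differentiableAt)
    (by
      rw [(hd 0).deriv, mul_zero, add_zero, norm_mul, norm_inv, norm_real,
        Real.norm_of_nonneg hM0.le, ← hMdef, mul_inv_cancel₀ hM0.ne']) (by simpa using hx)
    (fun s hs => by
      rw [(hd s).deriv, norm_mul, norm_inv, norm_real, Real.norm_of_nonneg hM0.le,
        ← div_eq_mul_inv, div_le_iff₀ hM0]
      refine (hbd _ ?_).trans_eq (by ring)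
      rw [mem_closedBall, dist_zero_right] at hs
      rw [mem_closedBall, dist_eq_norm, add_sub_cancel_left, norm_mul, norm_inv, norm_real,
        Real.norm_of_nonneg hM0.le, inv_mul_le_iff₀ hM0]
      linarith)
  have hscale : iteratedDeriv k (fun s : ℂ => exp (G (x + (M : ℂ)⁻¹ * s))) s =
      ((M : ℂ)⁻¹) ^ k * iteratedDeriv k (fun t => exp (G t)) (x + (M : ℂ)⁻¹ * s) := by
    have hd' : Differentiable ℂ fun t => exp (G (x + t)) :=
      (hG.comp (differentiable_id.const_add x)).cexp
    have h := congrFun (iteratedDeriv_comp_const_mul (n := k) hd'.contDiff (M : ℂ)⁻¹) s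
    rw [iteratedDeriv_comp_const_add k (fun t => exp (G t)) x] at h
    exact h
  rw [hscale, hshare _ hs1, mul_one, norm_pow, norm_inv, norm_real, Real.norm_of_nonneg hM0.le]
    at hs2
  have hinv : M⁻¹ < 1 / 2 := by
    rw [inv_eq_one_div, one_div_lt_one_div hM0 two_pos]; linarith
  have : (M⁻¹) ^ k ≤ M⁻¹ := pow_le_of_le_one (by positivity) (by linarith) (by omega)
  linarith

lemma iteratedDeriv_eq_pow_mul {φ : ℂ → ℂ} {a : ℂ} (h : ∀ t, deriv φ t = a * φ t) (k : ℕ)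
    (t : ℂ) : iteratedDeriv k φ t = a ^ k * φ t := by
  induction k generalizing t with
  | zero => simp
  | succ k ih => rw [iteratedDeriv_succ, funext ih, deriv_const_mul_field, h]; ring

/-- If a zero-free entire function `φ` satisfies `φ = 1 → φ⁽ᵏ⁾ = 1` with `k ≥ 1`, then `deriv φ = a * φ`
where either `a = 0` or `a ^ k = 1`. -/
lemma exists_deriv_eq_mul_of_eq_one_imp {φ : ℂ → ℂ} (hφ : Differentiable ℂ φ)
    (h0 : ∀ t, φ t ≠ 0) {k : ℕ} (hk : 1 ≤ k) (hshare : ∀ t, φ t = 1 → iteratedDeriv k φ t = 1) :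
    ∃ a : ℂ, (a = 0 ∨ a ^ k = 1) ∧ ∀ t, deriv φ t = a * φ t := by
  have hlog : Differentiable ℂ fun t => deriv φ t / φ t := hφ.deriv.div hφ h0
  obtain ⟨G, hG0, hG⟩ := hlog.isExactOn_univ.with_val_at 0 (log (φ 0))
  have hG' : ∀ t, HasDerivAt G (deriv φ t / φ t) t := fun t => hG t (mem_univ t)
  have hGd : Differentiable ℂ G := fun t => (hG' t).differentiableAt
  have hexp : ∀ t, exp (G t) = φ t := by
    have hq : ∀ t, HasDerivAt (fun t => exp (G t) / φ t) 0 t := fun t => by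
      refine ((hG' t).cexp.div (hφ t).hasDerivAt (h0 t)).congr_deriv ?_
      have := h0 t
      field_simp
      ring
    intro t
    have := is_const_of_deriv_eq_zero (fun t => (hq t).differentiableAt) (fun t => (hq t).deriv) t 0
    rw [hG0, exp_log (h0 0), div_self (h0 0), div_eq_one_iff_eq (h0 t)] at this
    exact this
  have hfun : (fun t => exp (G t)) = φ := funext hexp
  have hconst := deriv_eq_deriv_of_exp_eq_one_imp hGd hk
    (fun z hz => by rw [hfun]; exact hshare z (hexp z ▸ hz))
  have hderiv : ∀ t, deriv φ t = deriv G 0 * φ t := fun t => by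
    rw [hconst 0 t, (hG' t).deriv, div_mul_cancel₀ _ (h0 t)]
  refine ⟨deriv G 0, or_iff_not_imp_left.2 fun ha => ?_, hderiv⟩
  have haff : ∀ t, G t = deriv G 0 * t + G 0 := fun t => by
    have hd : ∀ t, HasDerivAt (fun t => G t - deriv G 0 * t) 0 t := fun t => by
      refine ((hGd t).hasDerivAt.sub ((hasDerivAt_id t).const_mul (deriv G 0))).congr_deriv ?_
      rw [hconst t 0, mul_one, sub_self]
    have := is_const_of_deriv_eq_zero (fun t => (hd t).differentiableAt) (fun t => (hd t).deriv) t 0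
    linear_combination this
  have hone : φ (-G 0 / deriv G 0) = 1 := by
    rw [← hexp, haff, mul_div_cancel₀ _ ha, neg_add_cancel, exp_zero]
  simpa [iteratedDeriv_eq_pow_mul hderiv, hone] using hshare _ hone

/-- Paper's Corollary 2.1, specialized to the zero-free case. -/
theorem power_share_one_IM_entire_zero_free
    (m : ℕ) (hm : 1 ≤ m) (f : (Fin m → ℂ) → ℂ)
    (hf : Differentiable ℂ f) (hnc : ¬∃ c : ℂ, ∀ z, f z = c)
    (h0 : ∀ z, f z ≠ 0)
    (u : Fin m → ℂ) (hu : ∑ j, Complex.normSq (u j) = 1)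
    (k n : ℕ) (hk : 1 ≤ k) (hn : k ≤ n)
    (hne : ¬∀ z, (dirDeriv u)^[k] (fun w => f w ^ n) z = 0)
    (hshare : ∀ z, f z ^ n = 1 ↔ (dirDeriv u)^[k] (fun w => f w ^ n) z = 1) :
    ∃ c : ℂ, c ≠ 0 ∧ (c / (n : ℂ)) ^ k = 1 ∧ ∀ z, f z = c * dirDeriv u f z := by
  set F : (Fin m → ℂ) → ℂ := fun w => f w ^ n with hFdef
  have hF : Differentiable ℂ F := hf.pow n
  have hF0 : ∀ z, F z ≠ 0 := fun z => pow_ne_zero n (h0 z)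
  have hn0 : (n : ℂ) ≠ 0 := by exact_mod_cast (by omega : n ≠ 0)
  have hline : ∀ z, ∃ a : ℂ, (a = 0 ∨ a ^ k = 1) ∧
      ∀ t : ℂ, dirDeriv u F (z + t • u) = a * F (z + t • u) := fun z => by
    obtain ⟨a, ha, h⟩ := exists_deriv_eq_mul_of_eq_one_imp (φ := fun t : ℂ => F (z + t • u))
      (fun t => (hasDerivAt_comp_line u hF z t).differentiableAt) (fun t => hF0 _) hk
      (fun t ht => by rw [iteratedDeriv_comp_line u hF]; exact (hshare _).1 ht)
    exact ⟨a, ha, fun t => (hasDerivAt_comp_line u hF z t).deriv ▸ h t⟩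
  obtain ⟨a, ha, hconst⟩ : ∃ a : ℂ, (a = 0 ∨ a ^ k = 1) ∧ ∀ z, dirDeriv u F z = a * F z := by
    have hfin : {a : ℂ | a = 0 ∨ a ^ k = 1}.Finite := by
      refine ((Polynomial.nthRoots k (1 : ℂ)).toFinset.finite_toSet.insert 0).subset ?_
      rintro a (rfl | ha)
      · exact mem_insert _ _
      · exact mem_insert_of_mem _ (by simpa [Polynomial.mem_nthRoots hk] using ha)
    have hcont : Continuous fun z => dirDeriv u F z / F z :=
      (differentiable_dirDeriv u hF).continuous.div hF.continuous hF0
    obtain ⟨a, ha, h⟩ := isPreconnected_univ.eqOn_const_of_mapsTo hfin.isDiscrete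
      hcont.continuousOn (fun z _ => by
        obtain ⟨b, hb, h⟩ := hline z
        have h' := h 0
        rw [zero_smul, add_zero] at h'
        change dirDeriv u F z / F z = 0 ∨ (dirDeriv u F z / F z) ^ k = 1
        rwa [h', mul_div_cancel_right₀ _ (hF0 z)]) ⟨0, Or.inl rfl⟩
    exact ⟨a, ha, fun z => (div_eq_iff (hF0 z)).1 (h (mem_univ z))⟩
  have hiter : ∀ z, (dirDeriv u)^[k] F z = a ^ k * F z := fun z => by
    have h := iteratedDeriv_eq_pow_mul (φ := fun t : ℂ => F (z + t • u)) (a := a)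
      (fun t => by rw [(hasDerivAt_comp_line u hF z t).deriv, hconst]) k 0
    simpa only [iteratedDeriv_comp_line u hF, zero_smul, add_zero] using h
  have ha0 : a ≠ 0 := by
    rintro rfl
    exact hne fun z => by rw [hiter, zero_pow (by omega), zero_mul]
  refine ⟨n / a, div_ne_zero hn0 ha0, ?_, fun z => ?_⟩
  · rw [div_div_cancel_left' hn0, inv_pow, ha.resolve_left ha0, inv_one]
  · have hd : dirDeriv u F z = n * f z ^ (n - 1) * dirDeriv u f z := by
      simp only [dirDeriv, hFdef]
      rw [((hf z).hasFDerivAt.pow n).fderiv]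
      simp
    have h := hconst z
    rw [hd] at h
    have hpow : F z = f z ^ (n - 1) * f z := (pow_sub_one_mul (by omega) (f z)).symm
    rw [hpow] at h
    have hp : f z ^ (n - 1) ≠ 0 := pow_ne_zero _ (h0 z)
    have h' : n * dirDeriv u f z = a * f z := mul_left_cancel₀ hp (by linear_combination h)
    rw [div_mul_eq_mul_div, h', mul_div_cancel_left₀ _ ha0]
end

section
/- Let f : ℂ → ℂ be a nonconstant entire function and let a, b be two distinct finite complex numbers. If f and f′ share the value a CM and share the value b CM, then f = f′ identically. (Rubel–Yang; the paper's Theorem 2.A.) -/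
section RubelYang

open Filter Asymptotics ValueDistribution Topology Metric Complex
open Real (circleAverage posLog)

/-- The mean of `|Re h|` over the circle of radius `r` around the origin. -/
noncomputable def meanAbsRe (h : ℂ → ℂ) (r : ℝ) : ℝ :=
  circleAverage (fun z ↦ |(h z).re|) 0 r

lemma meanAbsRe_nonneg (h : ℂ → ℂ) (r : ℝ) : 0 ≤ meanAbsRe h r :=
  Real.circleAverage_nonneg_of_nonneg fun _ _ ↦ abs_nonneg _

lemma continuous_meanAbsRe {h : ℂ → ℂ} (hh : Continuous h) : Continuous (meanAbsRe h) := by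
  unfold meanAbsRe
  fun_prop

lemma circleIntegrable_of_continuous {E : Type*} [NormedAddCommGroup E] {g : ℂ → E}
    (hg : Continuous g) (r : ℝ) : CircleIntegrable g 0 r :=
  hg.continuousOn.circleIntegrable'

lemma meanAbsRe_add_le {h k : ℂ → ℂ} (hh : Continuous h) (hk : Continuous k) (r : ℝ) :
    meanAbsRe (h + k) r ≤ meanAbsRe h r + meanAbsRe k r := by
  unfold meanAbsRe
  rw [← Real.circleAverage_fun_add (circleIntegrable_of_continuous (by fun_prop) r)
    (circleIntegrable_of_continuous (by fun_prop) r)]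
  refine Real.circleAverage_mono (circleIntegrable_of_continuous (by fun_prop) r)
    (circleIntegrable_of_continuous (by fun_prop) r) fun z _ ↦ ?_
  simpa using abs_add_le (h z).re (k z).re

lemma meanAbsRe_real_smul (t : ℝ) (h : ℂ → ℂ) (r : ℝ) :
    meanAbsRe (fun z ↦ (t : ℂ) * h z) r = |t| * meanAbsRe h r := by
  unfold meanAbsRe
  simp only [re_ofReal_mul, abs_mul]
  exact Real.circleAverage_fun_smul (a := |t|) (f := fun z ↦ |(h z).re|)

lemma norm_circleAverage_le (g : ℂ → ℂ) (r : ℝ) :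
    ‖circleAverage g 0 r‖ ≤ circleAverage (fun z ↦ ‖g z‖) 0 r := by
  rw [Real.circleAverage_def, Real.circleAverage_def, norm_smul,
    Real.norm_of_nonneg (by positivity), smul_eq_mul]
  gcongr
  exact intervalIntegral.norm_integral_le_integral_norm (by positivity)

/-- Differentiated Schwarz integral formula, as an estimate: the derivative of an entire function
is controlled by the mean of the absolute value of its real part on a larger circle. -/
lemma norm_deriv_le_meanAbsRe {h : ℂ → ℂ} (hh : Differentiable ℂ h) {R : ℝ} {w : ℂ}
    (hw : ‖w‖ < R) : ‖deriv h w‖ ≤ 2 * R / (R - ‖w‖) ^ 2 * meanAbsRe h R := by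
  have hR : 0 < R := (norm_nonneg w).trans_lt hw
  have hwb : w ∈ ball (0 : ℂ) R := by simpa using hw
  have hreint : CircleIntegrable (fun z ↦ (h z).re) 0 R :=
    circleIntegrable_of_continuous (by have := hh.continuous; fun_prop) R
  have hcint : CircleIntegrable (fun z ↦ (((h z).re : ℝ) : ℂ)) 0 R :=
    circleIntegrable_of_continuous (by have := hh.continuous; fun_prop) R
  set H : ℂ → ℂ := fun w ↦ circleAverage
    (fun ζ ↦ herglotzRieszKernel 0 w ζ • (((h ζ).re : ℝ) : ℂ)) 0 R with hH
  have hHan : AnalyticOnNhd ℂ H (ball 0 R) :=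
    analyticOnNhd_circleAverage_herglotzRieszKernel_smul hcint
  have hre : ∀ x ∈ ball (0 : ℂ) R, (H x).re = (h x).re := by
    intro x hx
    rw [hH, re_circleAverage_herglotzRieszKernel_smul hreint hx]
    have hmean := hh.diffContOnCl.circleAverage_re_herglotzRieszKernel_smul hx
    have hcont : ContinuousOn ((re ∘ herglotzRieszKernel 0 x) • h) (sphere (0 : ℂ) |R|) :=
      (Complex.continuous_re.comp_continuousOn (continuousOn_herglotzRieszKernel_sphere hx)).smul
        hh.continuous.continuousOn
    rw [← congrArg re hmean]
    refine Eq.trans ?_ (Complex.reCLM.circleAverage_comp_comm hcont.circleIntegrable')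
    congr 1
    ext z
    simp
  obtain ⟨c, hc⟩ := AnalyticOnNhd.eq_const_of_re_eq_const (c₀ := 0)
    (hHan.sub (fun x _ ↦ hh.analyticAt x)) (fun x hx ↦ by simp [hre x hx]) isOpen_ball
    ⟨⟨w, hwb⟩, (convex_ball (0 : ℂ) R).isPreconnected⟩
  have hd : deriv h w = circleAverage
      (fun ζ ↦ (2 * ζ / (ζ - w) ^ 2) • (((h ζ).re : ℝ) : ℂ)) 0 R := by
    have h1 := hasDerivAt_circleAverage_herglotzRieszKernel_smul hcint hwb
    refine ((h1.sub_const c).congr_of_eventuallyEq ?_).deriv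
    filter_upwards [isOpen_ball.mem_nhds hwb] with x hx
    have hx' : H x - h x = c := hc x hx
    rw [← hx', sub_sub_cancel]
  have hne : ∀ z ∈ sphere (0 : ℂ) |R|, R - ‖w‖ ≤ ‖z - w‖ ∧ ‖z‖ = R := by
    intro z hz
    have hz' : ‖z‖ = R := by simpa [abs_of_pos hR] using hz
    exact ⟨by rw [← hz']; exact norm_sub_norm_le z w, hz'⟩
  have hintg : CircleIntegrable (fun ζ ↦ (2 * ζ / (ζ - w) ^ 2) • (((h ζ).re : ℝ) : ℂ)) 0 R := by
    have hk : ContinuousOn (fun ζ : ℂ ↦ 2 * ζ / (ζ - w) ^ 2) (sphere 0 |R|) := by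
      refine ContinuousOn.div (by fun_prop) (by fun_prop) fun z hz ↦ pow_ne_zero 2 ?_
      rw [← norm_pos_iff]
      linarith [(hne z hz).1]
    have hre' : Continuous fun ζ ↦ (((h ζ).re : ℝ) : ℂ) := by
      have := hh.continuous
      fun_prop
    exact (hk.smul hre'.continuousOn).circleIntegrable'
  rw [hd]
  refine (norm_circleAverage_le _ _).trans ?_
  unfold meanAbsRe
  rw [← smul_eq_mul, ← Real.circleAverage_fun_smul]
  refine Real.circleAverage_mono hintg.norm
    (circleIntegrable_of_continuous (by have := hh.continuous; fun_prop) R) fun z hz ↦ ?_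
  obtain ⟨h1, h2⟩ := hne z hz
  have h3 : 0 < R - ‖w‖ := by linarith
  simp only [smul_eq_mul, norm_mul, norm_div, norm_pow, norm_real, Real.norm_eq_abs, h2,
    Complex.norm_ofNat]
  gcongr

/-- **Borel's growth lemma**: a continuous function tending to infinity grows by at most a factor
two on `[r, r + 1 / A r]` for arbitrarily large `r`. -/
lemma frequently_le_two_mul {A : ℝ → ℝ} (hA : Continuous A) (hlim : Tendsto A atTop atTop) :
    ∃ᶠ r in atTop, A (r + 1 / A r) ≤ 2 * A r := by
  intro hcon
  obtain ⟨r₀, hr₀⟩ := eventually_atTop.1 (hcon.and (hlim.eventually_ge_atTop 1))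
  set s : ℕ → ℝ := fun n ↦ (fun r ↦ r + 1 / A r)^[n] r₀ with hs
  have hsucc : ∀ n, s (n + 1) = s n + 1 / A (s n) := fun n ↦ by
    simp only [hs, Function.iterate_succ_apply']
  have key : ∀ n, r₀ ≤ s n ∧ (2 : ℝ) ^ n ≤ A (s n) ∧ s n ≤ r₀ + 2 - 2 * (1 / 2) ^ n := by
    intro n
    induction n with
    | zero => exact ⟨le_rfl, by rw [pow_zero]; exact (hr₀ r₀ le_rfl).2, by simp [hs]⟩
    | succ n ih =>
      obtain ⟨h1, h2, h3⟩ := ih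
      obtain ⟨h4, h5⟩ := hr₀ _ h1
      have h6 : 1 / A (s n) ≤ (1 / 2) ^ n := by
        rw [one_div_pow]
        gcongr
      have h7 : 0 < 1 / A (s n) := by positivity
      rw [hsucc]
      refine ⟨by linarith, ?_, ?_⟩
      · rw [pow_succ]
        linarith
      · rw [pow_succ]
        linarith
  obtain ⟨M, hM⟩ := (isCompact_Icc (a := r₀) (b := r₀ + 2)).bddAbove_image hA.continuousOn
  obtain ⟨n, hn⟩ := pow_unbounded_of_one_lt M (one_lt_two (α := ℝ))
  obtain ⟨h1, h2, h3⟩ := key n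
  have h4 : (0 : ℝ) < (1 / 2) ^ n := by positivity
  exact absurd (hM ⟨s n, ⟨h1, by linarith⟩, rfl⟩) (by simp only [not_le]; linarith)

section Small

variable {A : ℝ → ℝ} {F : Filter ℝ}

lemma isLittleO_of_nonneg_of_le {u v : ℝ → ℝ} (hu : ∀ r, 0 ≤ u r) (huv : ∀ᶠ r in F, u r ≤ v r)
    (hv : v =o[F] A) : u =o[F] A := by
  refine IsBigO.trans_isLittleO (IsBigO.of_bound 1 ?_) hv
  filter_upwards [huv] with r hr
  rw [one_mul, Real.norm_of_nonneg (hu r), Real.norm_of_nonneg ((hu r).trans hr)]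
  exact hr

lemma isLittleO_const_of_tendsto_atTop (hA : Tendsto A F atTop) (c : ℝ) :
    (fun _ ↦ c) =o[F] A :=
  isLittleO_const_left.2 (Or.inr (tendsto_norm_atTop_atTop.comp hA))

lemma proximity_isLittleO_of_norm_le (hA : Tendsto A F atTop) {g : ℂ → ℂ} (hg : Continuous g)
    (C : ℝ) (N : ℕ) (h : ∀ᶠ r in F, ∀ z ∈ sphere (0 : ℂ) |r|, ‖g z‖ ≤ C * A r ^ N) :
    proximity g ⊤ =o[F] A := by
  have h1 : (fun r ↦ posLog C + N * Real.log (A r)) =o[F] A :=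
    (isLittleO_const_of_tendsto_atTop hA _).add
      ((Real.isLittleO_log_id_atTop.comp_tendsto hA).const_mul_left _)
  refine isLittleO_of_nonneg_of_le (fun r ↦ proximity_nonneg r) ?_ h1
  filter_upwards [h, hA.eventually_ge_atTop 1] with r hr hr1
  rw [proximity_top]
  refine Real.circleAverage_mono_on_of_le_circle
    (circleIntegrable_of_continuous (by fun_prop) r) fun z hz ↦ ?_
  calc posLog ‖g z‖ ≤ posLog (C * A r ^ N) := Real.posLog_le_posLog (norm_nonneg _) (hr z hz)
    _ ≤ posLog C + posLog (A r ^ N) := Real.posLog_mul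
    _ = _ := by rw [Real.posLog_pow, Real.posLog_eq_log (hr1.trans (le_abs_self _))]

variable (A F) in
/-- An entire function is small with respect to the scale `A` along `F` if the proximity functions
of all its derivatives are `o(A)`. -/
def IsSmall (g : ℂ → ℂ) : Prop :=
  Differentiable ℂ g ∧ ∀ n : ℕ, proximity (iteratedDeriv n g) ⊤ =o[F] A

lemma Differentiable.iteratedDeriv_entire {g : ℂ → ℂ} (hg : Differentiable ℂ g) (n : ℕ) :
    Differentiable ℂ (iteratedDeriv n g) :=
  hg.contDiff.differentiable_iteratedDeriv (n := ⊤) n (by exact_mod_cast WithTop.coe_lt_top _)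

lemma Differentiable.meromorphic_entire {g : ℂ → ℂ} (hg : Differentiable ℂ g) : Meromorphic g :=
  fun z ↦ (hg.analyticAt z).meromorphicAt

lemma isSmall_deriv_of_meanAbsRe_le (hF : F ≤ atTop) (hA : Tendsto A F atTop)
    (hgrow : ∀ᶠ r in F, A (r + 1 / A r) ≤ 2 * A r) {c : ℝ} (hc : ∀ᶠ r in F, r ≤ c * A r)
    {h : ℂ → ℂ} (hh : Differentiable ℂ h) (hhA : ∀ r, meanAbsRe h r ≤ A r) :
    IsSmall A F (deriv h) := by
  have hd : Differentiable ℂ (deriv h) := fun z ↦ (hh.analyticAt z).deriv.differentiableAt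
  refine ⟨hd, fun n ↦ proximity_isLittleO_of_norm_le hA (hd.iteratedDeriv_entire n).continuous
    (n.factorial * 32 * c * 2 ^ n) (n + 4) ?_⟩
  filter_upwards [hF (eventually_ge_atTop 1), hA.eventually_ge_atTop 1, hgrow, hc]
    with r hr1 hA1 hgr hrc z hz
  have hzr : ‖z‖ = r := by simpa [abs_of_nonneg (zero_le_one.trans hr1)] using hz
  have hA0 : 0 < A r := by linarith
  have hB : ∀ w ∈ sphere z (1 / (2 * A r)), ‖deriv h w‖ ≤ 32 * c * A r ^ 4 := by
    intro w hw
    have hw' : ‖w‖ ≤ r + 1 / (2 * A r) := by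
      have h1 : ‖w - z‖ = 1 / (2 * A r) := by simpa [dist_eq_norm] using hw
      have h2 := norm_sub_norm_le w z
      linarith
    have hhalf : 1 / A r = 1 / (2 * A r) + 1 / (2 * A r) := by field_simp; ring
    have hpos : 0 < 1 / (2 * A r) := by positivity
    have hle1 : 1 / A r ≤ 1 := by rw [div_le_one hA0]; exact hA1
    have hlt : ‖w‖ < r + 1 / A r := by linarith
    refine (norm_deriv_le_meanAbsRe hh hlt).trans ?_
    have h3 : 1 / (2 * A r) ≤ r + 1 / A r - ‖w‖ := by linarith
    calc 2 * (r + 1 / A r) / (r + 1 / A r - ‖w‖) ^ 2 * meanAbsRe h (r + 1 / A r)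
        ≤ 2 * (c * A r + c * A r) / (1 / (2 * A r)) ^ 2 * (2 * A r) := by
          have h4 := meanAbsRe_nonneg h (r + 1 / A r)
          have h5 : 0 ≤ 2 * (c * A r + c * A r) := by linarith
          have h6 : 2 * (r + 1 / A r) ≤ 2 * (c * A r + c * A r) := by linarith
          exact mul_le_mul (div_le_div₀ h5 h6 (by positivity) (pow_le_pow_left₀ hpos.le h3 2))
            ((hhA _).trans hgr) h4 (div_nonneg h5 (by positivity))
      _ = 32 * c * A r ^ 4 := by field_simp; ring
  refine (norm_iteratedDeriv_le_of_forall_mem_sphere_norm_le n (by positivity)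
    hd.diffContOnCl hB).trans (le_of_eq ?_)
  rw [one_div, inv_pow, div_inv_eq_mul]
  ring

lemma IsSmall.deriv {g : ℂ → ℂ} (hg : IsSmall A F g) : IsSmall A F (deriv g) :=
  ⟨fun z ↦ (hg.1.analyticAt z).deriv.differentiableAt, fun n ↦ by
    rw [← iteratedDeriv_succ']
    exact hg.2 (n + 1)⟩

lemma IsSmall.proximity {g : ℂ → ℂ} (hg : IsSmall A F g) : proximity g ⊤ =o[F] A := by
  simpa using hg.2 0

lemma isSmall_const (hA : Tendsto A F atTop) (c : ℂ) : IsSmall A F fun _ ↦ c := by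
  refine ⟨by fun_prop, fun n ↦ ?_⟩
  refine proximity_isLittleO_of_norm_le hA
    ((differentiable_const c).iteratedDeriv_entire n).continuous ‖c‖ 0 (.of_forall fun r z _ ↦ ?_)
  rw [iteratedDeriv_const]
  split_ifs <;> simp

lemma IsSmall.add (hA : Tendsto A F atTop) {g k : ℂ → ℂ} (hg : IsSmall A F g)
    (hk : IsSmall A F k) : IsSmall A F (g + k) := by
  refine ⟨hg.1.add hk.1, fun n ↦ ?_⟩
  rw [show iteratedDeriv n (g + k) = iteratedDeriv n g + iteratedDeriv n k from funext fun z ↦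
    iteratedDeriv_add hg.1.contDiff.contDiffAt hk.1.contDiff.contDiffAt]
  exact isLittleO_of_nonneg_of_le (fun r ↦ proximity_nonneg r) (.of_forall <|
    proximity_add_top_le (hg.1.iteratedDeriv_entire n).meromorphic_entire
      (hk.1.iteratedDeriv_entire n).meromorphic_entire)
    (((hg.2 n).add (hk.2 n)).add (isLittleO_const_of_tendsto_atTop hA _))

lemma proximity_iteratedDeriv_mul_isLittleO (hA : Tendsto A F atTop) {g k : ℂ → ℂ}
    (hg : Differentiable ℂ g) (hk : Differentiable ℂ k) (n : ℕ)
    (hg' : ∀ i ≤ n, proximity (iteratedDeriv i g) ⊤ =o[F] A)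
    (hk' : ∀ i ≤ n, proximity (iteratedDeriv i k) ⊤ =o[F] A) :
    proximity (iteratedDeriv n (g * k)) ⊤ =o[F] A := by
  have hrw : iteratedDeriv n (g * k) = ∑ i ∈ Finset.range (n + 1),
      (fun _ ↦ (n.choose i : ℂ)) * (iteratedDeriv i g * iteratedDeriv (n - i) k) := by
    funext z
    rw [iteratedDeriv_mul hg.contDiff.contDiffAt hk.contDiff.contDiffAt]
    simp [mul_assoc]
  have hmer : ∀ i, Meromorphic (iteratedDeriv i g) ∧ Meromorphic (iteratedDeriv i k) := fun i ↦
    ⟨(hg.iteratedDeriv_entire i).meromorphic_entire, (hk.iteratedDeriv_entire i).meromorphic_entire⟩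
  have hmc : ∀ c : ℂ, Meromorphic fun _ ↦ c := fun c ↦ (differentiable_const c).meromorphic_entire
  rw [hrw]
  refine isLittleO_of_nonneg_of_le (fun r ↦ proximity_nonneg r) (.of_forall <|
    proximity_sum_top_le _ _ fun i _ ↦ (hmc _).mul ((hmer i).1.mul (hmer _).2)) ?_
  refine IsLittleO.add ?_ (isLittleO_const_of_tendsto_atTop hA _)
  rw [show (∑ i ∈ Finset.range (n + 1), proximity ((fun _ ↦ (n.choose i : ℂ)) *
    (iteratedDeriv i g * iteratedDeriv (n - i) k)) ⊤) = fun r ↦ ∑ i ∈ Finset.range (n + 1),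
    proximity ((fun _ ↦ (n.choose i : ℂ)) * (iteratedDeriv i g * iteratedDeriv (n - i) k)) ⊤ r
    from funext fun r ↦ by simp]
  refine IsLittleO.fun_sum fun i hi ↦ ?_
  have hi' : i ≤ n := Nat.lt_succ_iff.1 (Finset.mem_range.1 hi)
  refine isLittleO_of_nonneg_of_le (fun r ↦ proximity_nonneg r) (.of_forall fun r ↦
    (proximity_mul_top_le (hmc _) ((hmer i).1.mul (hmer _).2) r).trans
      (add_le_add_right (proximity_mul_top_le (hmer i).1 (hmer _).2 r) _)) ?_
  exact ((isSmall_const hA _).proximity).add ((hg' i hi').add (hk' _ (Nat.sub_le n i)))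

lemma IsSmall.mul (hA : Tendsto A F atTop) {g k : ℂ → ℂ} (hg : IsSmall A F g)
    (hk : IsSmall A F k) : IsSmall A F (g * k) :=
  ⟨hg.1.mul hk.1, fun n ↦ proximity_iteratedDeriv_mul_isLittleO hA hg.1 hk.1 n
    (fun i _ ↦ hg.2 i) fun i _ ↦ hk.2 i⟩

lemma isSmall_exp (hA : Tendsto A F atTop) {h : ℂ → ℂ} (hh : Differentiable ℂ h)
    (hd : IsSmall A F (deriv h)) (ho : meanAbsRe h =o[F] A) :
    IsSmall A F fun z ↦ exp (h z) := by
  have he : Differentiable ℂ fun z ↦ exp (h z) := hh.cexp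
  have hde : deriv (fun z ↦ exp (h z)) = (fun z ↦ exp (h z)) * deriv h :=
    funext fun z ↦ (hh z).hasDerivAt.cexp.deriv
  refine ⟨he, fun n ↦ ?_⟩
  induction n using Nat.strong_induction_on with
  | _ n ih =>
    rcases n with _ | n
    · rw [iteratedDeriv_zero]
      refine isLittleO_of_nonneg_of_le (fun r ↦ proximity_nonneg r) (.of_forall fun r ↦ ?_) ho
      have := hh.continuous
      rw [proximity_top]
      refine Real.circleAverage_mono (circleIntegrable_of_continuous (by fun_prop) r)
        (circleIntegrable_of_continuous (by fun_prop) r) fun z _ ↦ ?_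
      rw [Complex.norm_exp, Real.posLog_apply, Real.log_exp]
      exact max_le (abs_nonneg _) (le_abs_self _)
    · rw [iteratedDeriv_succ', hde]
      exact proximity_iteratedDeriv_mul_isLittleO hA he hd.1 n (fun i hi ↦ ih i (by omega))
        fun i _ ↦ hd.2 i

end Small

section Borel

variable {A : ℝ → ℝ} {F : Filter ℝ}

lemma IsSmall.sub (hA : Tendsto A F atTop) {g k : ℂ → ℂ} (hg : IsSmall A F g)
    (hk : IsSmall A F k) : IsSmall A F (g - k) := by
  convert hg.add hA ((isSmall_const hA (-1)).mul hA hk) using 1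
  ext z
  simp [sub_eq_add_neg]

lemma IsSmall.proximity_inv (hF : F ≤ atTop) (hA : Tendsto A F atTop) {g : ℂ → ℂ}
    (hg : IsSmall A F g) : ValueDistribution.proximity g⁻¹ ⊤ =o[F] A := by
  have hmer := hg.1.meromorphic_entire
  have hlc : logCounting g ⊤ = 0 := by
    rw [logCounting_top, negPart_eq_zero.2
      (MeromorphicOn.AnalyticOnNhd.divisor_nonneg fun z _ ↦ hg.1.analyticAt z), map_zero]
  refine isLittleO_of_nonneg_of_le (fun r ↦ proximity_nonneg r) ?_ (hg.proximity.add
    (isLittleO_const_of_tendsto_atTop hA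
      (max |Real.log ‖g 0‖| |Real.log ‖meromorphicTrailingCoeffAt g 0‖|)))
  filter_upwards [hF (eventually_ge_atTop 1)] with r hr
  have h1 := characteristic_sub_characteristic_inv_le hmer (R := r)
  have h2 : (0 : ℝ) ≤ logCounting g⁻¹ ⊤ r := logCounting_nonneg hr
  have h3 := (abs_le.1 h1).1
  simp only [characteristic, Pi.add_apply, hlc, Pi.zero_apply] at h3
  linarith

lemma meanAbsRe_isLittleO_of_exp_mul_eq (hF : F ≤ atTop) (hA : Tendsto A F atTop)
    {g k h : ℂ → ℂ} (hg : IsSmall A F g) (hk : IsSmall A F k) (hh : Differentiable ℂ h)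
    {z₀ : ℂ} (hz₀ : g z₀ ≠ 0) (heq : ∀ z, exp (h z) * g z = k z) : meanAbsRe h =o[F] A := by
  refine isLittleO_of_nonneg_of_le (meanAbsRe_nonneg h) ?_
    ((hk.proximity.add (hk.proximity_inv hF hA)).add (hg.proximity.add (hg.proximity_inv hF hA)))
  filter_upwards [hF (eventually_ge_atTop 1)] with r hr
  have hpos (x : ℝ) : |Real.log x| = posLog x + posLog x⁻¹ := by
    have h1 := Real.half_mul_log_add_log_abs (x := x)
    have h2 := Real.half_mul_log_add_log_abs (x := x⁻¹)
    rw [Real.log_inv, abs_neg] at h2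
    linarith
  have hintg (f : ℂ → ℂ) (hf : Meromorphic f) : CircleIntegrable (fun z ↦ posLog ‖f z‖) 0 r :=
    hf.meromorphicOn.circleIntegrable_posLog_norm
  have hgm := hg.1.meromorphic_entire
  have hkm := hk.1.meromorphic_entire
  have hsum (f : ℂ → ℂ) (hf : Meromorphic f) : CircleIntegrable (fun z ↦ |Real.log ‖f z‖|) 0 r ∧
      circleAverage (fun z ↦ |Real.log ‖f z‖|) 0 r = proximity f ⊤ r + proximity f⁻¹ ⊤ r := by
    simp only [hpos, ← norm_inv, proximity_top]
    exact ⟨(hintg f hf).add (hintg f⁻¹ hf.inv),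
      Real.circleAverage_fun_add (hintg f hf) (hintg f⁻¹ hf.inv)⟩
  have hcod : (fun z ↦ |(h z).re|) =ᶠ[codiscreteWithin (sphere 0 |r|)]
      fun z ↦ |Real.log ‖k z‖ - Real.log ‖g z‖| := by
    have h1 : g ⁻¹' {0}ᶜ ∈ codiscrete ℂ :=
      AnalyticOnNhd.preimage_zero_mem_codiscrete (fun z _ ↦ hg.1.analyticAt z) hz₀
    filter_upwards [codiscreteWithin_mono (Set.subset_univ _) h1] with z hz
    rw [← heq, norm_mul, Real.log_mul (norm_ne_zero_iff.2 (exp_ne_zero _))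
      (norm_ne_zero_iff.2 hz), norm_exp, Real.log_exp, add_sub_cancel_right]
  have hcont := hh.continuous
  rw [← (hsum k hkm).2, ← (hsum g hgm).2,
    ← Real.circleAverage_fun_add (hsum k hkm).1 (hsum g hgm).1]
  unfold meanAbsRe
  have hlog (f : ℂ → ℂ) (hf : Meromorphic f) : CircleIntegrable (fun z ↦ Real.log ‖f z‖) 0 r :=
    hf.meromorphicOn.circleIntegrable_log_norm
  rw [Real.circleAverage_congr_codiscreteWithin hcod (by linarith)]
  exact Real.circleAverage_mono ((hlog k hkm).sub (hlog g hgm)).abs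
    ((hsum k hkm).1.add (hsum g hgm).1) fun z _ ↦ abs_sub _ _

lemma eq_zero_of_deriv_mul_eq {D g : ℂ → ℂ} (hD : Differentiable ℂ D) (hg : Differentiable ℂ g)
    (hW : ∀ z, deriv D z * g z = D z * deriv g z) {z₀ : ℂ} (hz₀ : g z₀ ≠ 0) (hD₀ : D z₀ = 0) :
    ∀ z, D z = 0 := by
  obtain ⟨ε, hε, hball⟩ := Metric.eventually_nhds_iff_ball.1
    (hg.continuous.continuousAt.eventually_ne hz₀)
  have hdiff : ∀ z ∈ ball z₀ ε, HasDerivAt (fun z ↦ D z / g z) 0 z := fun z hz ↦ by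
    have h := (hD z).hasDerivAt.fun_div (hg z).hasDerivAt (hball z hz)
    rwa [hW, sub_self, zero_div] at h
  have h0 : D =ᶠ[𝓝 z₀] 0 := by
    filter_upwards [ball_mem_nhds z₀ hε] with z hz
    have := (convex_ball z₀ ε).is_const_of_fderivWithin_eq_zero (𝕜 := ℂ)
      (fun z hz ↦ (hdiff z hz).differentiableAt.differentiableWithinAt)
      (fun z hz ↦ by
        rw [fderivWithin_of_isOpen isOpen_ball hz, (hdiff z hz).hasFDerivAt.fderiv]
        ext; simp) hz (mem_ball_self hε)
    simpa [hD₀, hball z hz] using this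
  exact fun z ↦ congrFun (AnalyticOnNhd.eq_of_eventuallyEq (fun z _ ↦ hD.analyticAt z)
    (fun z _ ↦ analyticAt_const) h0) z

/-- **Borel's theorem** on exponential sums with small coefficients. -/
theorem eq_zero_of_sum_mul_exp_eq_zero (hF : F ≤ atTop) (hA : Tendsto A F atTop) {ι : Type*}
    {h : ι → ℂ → ℂ} (hh : ∀ i, Differentiable ℂ (h i)) (hd : ∀ i, IsSmall A F (deriv (h i)))
    (S : Finset ι) (hS : ∀ i ∈ S, ∀ j ∈ S, i ≠ j → ¬ meanAbsRe (h i - h j) =o[F] A)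
    {g : ι → ℂ → ℂ} (hg : ∀ i ∈ S, IsSmall A F (g i))
    (hsum : ∀ z, ∑ i ∈ S, g i z * exp (h i z) = 0) : ∀ i ∈ S, ∀ z, g i z = 0 := by
  classical
  induction S using Finset.induction_on generalizing g with
  | empty => simp
  | insert n T hn ih =>
    simp only [Finset.sum_insert hn] at hsum
    have hST : ∀ i ∈ T, ∀ j ∈ T, i ≠ j → ¬ meanAbsRe (h i - h j) =o[F] A := fun i hi j hj ↦
      hS i (Finset.mem_insert_of_mem hi) j (Finset.mem_insert_of_mem hj)
    have hgT : ∀ i ∈ T, IsSmall A F (g i) := fun i hi ↦ hg i (Finset.mem_insert_of_mem hi)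
    have hgn : IsSmall A F (g n) := hg n (Finset.mem_insert_self n T)
    by_cases h0 : ∀ z, g n z = 0
    · have := ih hST hgT (fun z ↦ by simpa [h0 z] using hsum z)
      exact fun i hi ↦ (Finset.mem_insert.1 hi).elim (fun h1 ↦ h1 ▸ h0) (this i)
    exfalso
    push Not at h0
    obtain ⟨z₀, hz₀⟩ := h0
    set G : ι → ℂ → ℂ := fun j ↦ (deriv (g j) * g n - g j * deriv (g n)) +
      g j * g n * (deriv (h j) - deriv (h n)) with hG
    have hGs : ∀ i ∈ T, IsSmall A F (G i) := fun i hi ↦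
      (((hgT i hi).deriv.mul hA hgn).sub hA ((hgT i hi).mul hA hgn.deriv)).add hA
        (((hgT i hi).mul hA hgn).mul hA ((hd i).sub hA (hd n)))
    have hG0 : ∀ z, ∑ i ∈ T, G i z * exp (h i z) = 0 := by
      intro z
      have hterm : ∀ i ∈ insert n T, HasDerivAt (fun z ↦ g i z * exp (h i z))
          (deriv (g i) z * exp (h i z) + g i z * (exp (h i z) * deriv (h i) z)) z := fun i hi ↦
        ((hg i hi).1 z).hasDerivAt.mul ((hh i) z).hasDerivAt.cexp
      have h1 : HasDerivAt (fun z ↦ ∑ i ∈ T, g i z * exp (h i z)) _ z :=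
        HasDerivAt.fun_sum fun i hi ↦ hterm i (Finset.mem_insert_of_mem hi)
      have h2 := (hterm n (Finset.mem_insert_self n T)).add h1
      have h3 : deriv (g n) z * exp (h n z) + g n z * (exp (h n z) * deriv (h n) z) +
          ∑ i ∈ T, (deriv (g i) z * exp (h i z) + g i z * (exp (h i z) * deriv (h i) z)) = 0 := by
        refine h2.unique ((hasDerivAt_const z (0 : ℂ)).congr_of_eventuallyEq (.of_forall fun z ↦ ?_))
        exact hsum z
      have h4 : ∑ i ∈ T, G i z * exp (h i z) =
          g n z * ∑ i ∈ T, (deriv (g i) z * exp (h i z) + g i z * (exp (h i z) * deriv (h i) z)) -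
          (deriv (g n) z + g n z * deriv (h n) z) * ∑ i ∈ T, g i z * exp (h i z) := by
        rw [Finset.mul_sum, Finset.mul_sum, ← Finset.sum_sub_distrib]
        refine Finset.sum_congr rfl fun i _ ↦ ?_
        simp only [hG, Pi.add_apply, Pi.sub_apply, Pi.mul_apply]
        ring
      rw [h4]
      linear_combination g n z * h3 - (deriv (g n) z + g n z * deriv (h n) z) * hsum z
    have hGz := ih hST hGs hG0
    have hT0 : ∀ j ∈ T, ∀ z, g j z = 0 := by
      intro j hj
      by_contra! hne
      obtain ⟨z₁, hz₁⟩ := hne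
      set C : ℂ := exp (h j z₀ - h n z₀) * g j z₀ / g n z₀ with hC
      have hD : Differentiable ℂ fun z ↦ exp (h j z - h n z) * g j z - C * g n z :=
        ((((hh j).sub (hh n)).cexp).mul (hgT j hj).1).sub (hgn.1.const_mul C)
      have hrel := eq_zero_of_deriv_mul_eq hD hgn.1 (fun z ↦ ?_) hz₀
        (by simp only [hC]; field_simp; ring)
      · refine hS j (Finset.mem_insert_of_mem hj) n (Finset.mem_insert_self n T)
          (fun h1 ↦ hn (h1 ▸ hj)) ?_
        exact meanAbsRe_isLittleO_of_exp_mul_eq hF hA (hgT j hj)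
          ((isSmall_const hA C).mul hA hgn) ((hh j).sub (hh n)) hz₁
          fun z ↦ by simpa using sub_eq_zero.1 (hrel z)
      · have h1 : HasDerivAt (fun z ↦ exp (h j z - h n z) * g j z - C * g n z) _ z :=
          ((((hh j z).hasDerivAt.sub (hh n z).hasDerivAt).cexp).mul
            ((hgT j hj).1 z).hasDerivAt).sub ((hgn.1 z).hasDerivAt.const_mul C)
        rw [h1.deriv]
        have h2 := hGz j hj z
        simp only [hG, Pi.add_apply, Pi.sub_apply, Pi.mul_apply] at h2
        simp only [Pi.sub_apply]
        linear_combination exp (h j z - h n z) * h2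
    have h5 := hsum z₀
    rw [Finset.sum_eq_zero fun i hi ↦ by rw [hT0 i hi, zero_mul], add_zero] at h5
    exact (mul_ne_zero hz₀ (exp_ne_zero _)) h5

end Borel

section Classes

variable {A : ℝ → ℝ} {F : Filter ℝ}

lemma IsSmall.sum (hA : Tendsto A F atTop) {ι : Type*} (S : Finset ι) {g : ι → ℂ → ℂ}
    (hg : ∀ i ∈ S, IsSmall A F (g i)) : IsSmall A F (∑ i ∈ S, g i) :=
  Finset.sum_induction g (IsSmall A F) (fun _ _ ↦ IsSmall.add hA) (isSmall_const hA 0) hg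

lemma meanAbsRe_linearCombination_isLittleO {h k : ℂ → ℂ} (hh : Continuous h) (hk : Continuous k)
    (hho : meanAbsRe h =o[F] A) (hko : meanAbsRe k =o[F] A) (s t : ℝ) :
    meanAbsRe (fun z ↦ (s : ℂ) * h z + (t : ℂ) * k z) =o[F] A := by
  refine isLittleO_of_nonneg_of_le (meanAbsRe_nonneg _) (.of_forall fun r ↦ ?_)
    ((hho.const_mul_left |s|).add (hko.const_mul_left |t|))
  rw [← meanAbsRe_real_smul, ← meanAbsRe_real_smul]
  exact meanAbsRe_add_le (by fun_prop) (by fun_prop) r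

open Classical in
/-- Borel's theorem without independence assumption: in a vanishing exponential sum with small
coefficients, the terms whose exponents agree up to `o(A)` cancel among themselves. -/
theorem sum_equivalent_mul_exp_eq_zero (hF : F ≤ atTop) (hA : Tendsto A F atTop) {ι : Type*}
    [Fintype ι] {h : ι → ℂ → ℂ} (hh : ∀ i, Differentiable ℂ (h i))
    (hd : ∀ i, IsSmall A F (deriv (h i))) {g : ι → ℂ → ℂ} (hg : ∀ i, IsSmall A F (g i))
    (hsum : ∀ z, ∑ i, g i z * exp (h i z) = 0) (i : ι) (z : ℂ) :
    ∑ j, (if meanAbsRe (h j - h i) =o[F] A then g j z * exp (h j z - h i z) else 0) = 0 := by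
  have hc : ∀ i, Continuous (h i) := fun i ↦ (hh i).continuous
  let R : Setoid ι :=
    { r := fun j i ↦ meanAbsRe (h j - h i) =o[F] A
      iseqv :=
        { refl := fun i ↦ by
            have : meanAbsRe (h i - h i) = fun _ ↦ 0 := by
              funext r
              simp [meanAbsRe, Real.circleAverage_const]
            rw [this]
            exact isLittleO_zero _ _
          symm := fun {i j} hij ↦ by
            convert meanAbsRe_linearCombination_isLittleO ((hc i).sub (hc j)) ((hc i).sub (hc j))
              hij hij (-1) 0 using 2
            ext z
            simp
          trans := fun {i j k} hij hjk ↦ by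
            convert meanAbsRe_linearCombination_isLittleO ((hc i).sub (hc j)) ((hc j).sub (hc k))
              hij hjk 1 1 using 2
            ext z
            simp } }
  have hR : ∀ j i, meanAbsRe (h j - h i) =o[F] A ↔ (⟦j⟧ : Quotient R) = ⟦i⟧ := fun j i ↦
    (Quotient.eq (r := R)).symm
  have hexp : ∀ j i, meanAbsRe (h j - h i) =o[F] A → IsSmall A F fun z ↦ exp (h j z - h i z) := by
    intro j i hji
    refine isSmall_exp hA ((hh j).sub (hh i)) ?_ hji
    convert (hd j).sub hA (hd i) using 1
    exact funext fun z ↦ deriv_sub (hh j z) (hh i z)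
  let G : Quotient R → ℂ → ℂ := fun q ↦ ∑ j with (⟦j⟧ : Quotient R) = q,
    g j * fun z ↦ exp (h j z - h q.out z)
  have hG := eq_zero_of_sum_mul_exp_eq_zero hF hA (h := fun q : Quotient R ↦ h q.out) (g := G)
    (fun q ↦ hh _) (fun q ↦ hd _) Finset.univ
    (fun p _ q _ hpq hrel ↦ hpq (by simpa using (hR _ _).1 hrel))
    (fun q _ ↦ IsSmall.sum hA _ fun j hj ↦ (hg j).mul hA (hexp _ _ ((hR _ _).2 (by
      simpa using hj)))) (fun z ↦ by
        rw [← hsum z, ← Finset.sum_fiberwise _ fun j ↦ (⟦j⟧ : Quotient R)]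
        refine Finset.sum_congr rfl fun q _ ↦ ?_
        simp only [G, Finset.sum_apply, Pi.mul_apply, Finset.sum_mul]
        refine Finset.sum_congr rfl fun j _ ↦ ?_
        rw [mul_assoc, ← exp_add, sub_add_cancel])
    ⟦i⟧ (Finset.mem_univ _) z
  simp only [G, Finset.sum_apply, Pi.mul_apply] at hG
  simp only [hR, ← Finset.sum_filter]
  have h1 := congrArg (· * exp (h (⟦i⟧ : Quotient R).out z - h i z)) hG
  simp only [zero_mul, Finset.sum_mul] at h1
  rw [← h1]
  refine Finset.sum_congr rfl fun j _ ↦ ?_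
  rw [mul_assoc, ← exp_add, sub_add_sub_cancel]

end Classes

lemma exists_eq_exp {φ : ℂ → ℂ} (hφ : Differentiable ℂ φ) (h0 : ∀ z, φ z ≠ 0) :
    ∃ α : ℂ → ℂ, Differentiable ℂ α ∧ ∀ z, φ z = exp (α z) := by
  have hφ' : Differentiable ℂ (deriv φ) := fun z ↦ (hφ.analyticAt z).deriv.differentiableAt
  obtain ⟨g, hg⟩ := (hφ'.div hφ h0).isExactOn_univ
  have hg' : ∀ z, HasDerivAt g (deriv φ z / φ z) z := fun z ↦ hg z (Set.mem_univ z)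
  have hconst : ∀ z, φ z * exp (-g z) = φ 0 * exp (-g 0) := fun z ↦
    is_const_of_deriv_eq_zero
      (fun z ↦ ((hφ z).hasDerivAt.fun_mul (hg' z).fun_neg.cexp).differentiableAt)
      (fun z ↦ by
        rw [((hφ z).hasDerivAt.fun_mul (hg' z).fun_neg.cexp).deriv]
        field_simp [h0 z]
        ring) z 0
  refine ⟨fun z ↦ g z + (log (φ 0) - g 0), fun z ↦ ((hg' z).add_const _).differentiableAt,
    fun z ↦ ?_⟩
  have h1 := hconst z
  rw [exp_add, exp_sub, exp_log (h0 0)]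
  rw [exp_neg, exp_neg] at h1
  field_simp at h1 ⊢
  linear_combination h1

lemma exists_le_mul_meanAbsRe {h : ℂ → ℂ} (hh : Differentiable ℂ h) {w : ℂ} (hw : deriv h w ≠ 0) :
    ∃ c > 0, ∀ᶠ r in atTop, r ≤ c * meanAbsRe h r := by
  have hpos : 0 < ‖deriv h w‖ := norm_pos_iff.2 hw
  refine ⟨8 / ‖deriv h w‖, by positivity, ?_⟩
  filter_upwards [eventually_ge_atTop (2 * ‖w‖ + 1)] with r hr
  have hw0 := norm_nonneg w
  have h1 := norm_deriv_le_meanAbsRe hh (R := r) (w := w) (by linarith)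
  have h2 : r / 2 ≤ r - ‖w‖ := by linarith
  have hr0 : 0 < r := by linarith
  have h3 : ‖deriv h w‖ ≤ 8 / r * meanAbsRe h r := by
    refine h1.trans ?_
    have := meanAbsRe_nonneg h r
    calc 2 * r / (r - ‖w‖) ^ 2 * meanAbsRe h r ≤ 2 * r / (r / 2) ^ 2 * meanAbsRe h r := by gcongr
      _ = 8 / r * meanAbsRe h r := by field_simp; ring
  rw [div_mul_eq_mul_div, le_div_iff₀ hpos]
  rw [div_mul_eq_mul_div, le_div_iff₀ hr0] at h3
  linarith

/-- Unless two entire functions are both constant, their derivatives are small with respect to the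
sum of their mean absolute real parts, along a suitable filter. -/
lemma exists_filter_isSmall_deriv {α β : ℂ → ℂ} (hα : Differentiable ℂ α)
    (hβ : Differentiable ℂ β) {w : ℂ} (hw : deriv α w ≠ 0 ∨ deriv β w ≠ 0) :
    ∃ F : Filter ℝ, F.NeBot ∧ F ≤ atTop ∧ Tendsto (meanAbsRe α + meanAbsRe β) F atTop ∧
      IsSmall (meanAbsRe α + meanAbsRe β) F (deriv α) ∧
      IsSmall (meanAbsRe α + meanAbsRe β) F (deriv β) := by
  set A := meanAbsRe α + meanAbsRe β with hAdef
  have hαA : ∀ r, meanAbsRe α r ≤ A r := fun r ↦ le_add_of_nonneg_right (meanAbsRe_nonneg β r)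
  have hβA : ∀ r, meanAbsRe β r ≤ A r := fun r ↦ le_add_of_nonneg_left (meanAbsRe_nonneg α r)
  obtain ⟨c, hc, hcA⟩ : ∃ c > 0, ∀ᶠ r in atTop, r ≤ c * A r := by
    rcases hw with hw | hw
    · obtain ⟨c, hc, h⟩ := exists_le_mul_meanAbsRe hα hw
      exact ⟨c, hc, h.mono fun r hr ↦ hr.trans (by gcongr; exact hαA r)⟩
    · obtain ⟨c, hc, h⟩ := exists_le_mul_meanAbsRe hβ hw
      exact ⟨c, hc, h.mono fun r hr ↦ hr.trans (by gcongr; exact hβA r)⟩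
  have hA : Tendsto A atTop atTop := by
    have h1 : Tendsto (fun r ↦ c * A r) atTop atTop := tendsto_atTop_mono' _ hcA tendsto_id
    exact (tendsto_const_mul_atTop_of_pos hc).1 h1
  have hAc : Continuous A :=
    (continuous_meanAbsRe hα.continuous).add (continuous_meanAbsRe hβ.continuous)
  have hgrow : ∀ᶠ r in atTop ⊓ 𝓟 {r | A (r + 1 / A r) ≤ 2 * A r}, A (r + 1 / A r) ≤ 2 * A r :=
    eventually_inf_principal.2 (.of_forall fun _ hr ↦ hr)
  have hFA := hA.mono_left (inf_le_left : atTop ⊓ 𝓟 {r | A (r + 1 / A r) ≤ 2 * A r} ≤ atTop)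
  exact ⟨_, frequently_iff_neBot.1 (frequently_le_two_mul hAc hA), inf_le_left, hFA,
    isSmall_deriv_of_meanAbsRe_le inf_le_left hFA hgrow (hcA.filter_mono inf_le_left) hα hαA,
    isSmall_deriv_of_meanAbsRe_le inf_le_left hFA hgrow (hcA.filter_mono inf_le_left) hβ hβA⟩

section Lattice

variable {A : ℝ → ℝ} {F : Filter ℝ} {α β : ℂ → ℂ}

lemma isLittleO_of_isLittleO_of_det_ne_zero (hα : Continuous α) (hβ : Continuous β) {m n p q : ℤ}
    (hmn : meanAbsRe (fun z ↦ m * α z + n * β z) =o[F] A)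
    (hpq : meanAbsRe (fun z ↦ p * α z + q * β z) =o[F] A) (hdet : m * q - n * p ≠ 0) (s t : ℝ) :
    meanAbsRe (fun z ↦ (s : ℂ) * α z + t * β z) =o[F] A := by
  have hD : ((m * q - n * p : ℤ) : ℂ) ≠ 0 := by exact_mod_cast hdet
  convert meanAbsRe_linearCombination_isLittleO (by fun_prop) (by fun_prop) hmn hpq
    ((s * q - t * p) / (m * q - n * p : ℤ)) ((m * t - n * s) / (m * q - n * p : ℤ)) using 2
  ext z
  push_cast at hD ⊢
  rw [div_mul_eq_mul_div, div_mul_eq_mul_div, ← add_div, eq_div_iff hD]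
  ring

/-- The integer combinations of `α` and `β` of negligible growth form a saturated lattice of rank
at most one. -/
lemma isLittleO_iff_mul_eq_mul [F.NeBot] (hα : Continuous α) (hβ : Continuous β)
    (hA : Tendsto (meanAbsRe α + meanAbsRe β) F atTop) {p q : ℤ}
    (hpq : meanAbsRe (fun z ↦ p * α z + q * β z) =o[F] (meanAbsRe α + meanAbsRe β))
    (h0 : p ≠ 0 ∨ q ≠ 0) (m n : ℤ) :
    meanAbsRe (fun z ↦ m * α z + n * β z) =o[F] (meanAbsRe α + meanAbsRe β) ↔ m * q = n * p := by
  constructor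
  · intro hmn
    by_contra hne
    have key := isLittleO_of_isLittleO_of_det_ne_zero hα hβ hmn hpq (sub_ne_zero.2 hne)
    have h1 : meanAbsRe α =o[F] (meanAbsRe α + meanAbsRe β) := by simpa using key 1 0
    have h2 : meanAbsRe β =o[F] (meanAbsRe α + meanAbsRe β) := by simpa using key 0 1
    refine isLittleO_irrefl ?_ (h1.add h2)
    exact ((hA.eventually_ne_atTop 0).frequently)
  · intro heq
    have hcomb (s : ℝ) (hm : s * p = m) (hn : s * q = n) :
        meanAbsRe (fun z ↦ m * α z + n * β z) =o[F] (meanAbsRe α + meanAbsRe β) := by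
      convert meanAbsRe_linearCombination_isLittleO (by fun_prop) (by fun_prop) hpq hpq s 0 using 2
      ext z
      have hm' : (s : ℂ) * p = m := by exact_mod_cast hm
      have hn' : (s : ℂ) * q = n := by exact_mod_cast hn
      rw [← hm', ← hn']
      push_cast
      ring
    have heq' : (m : ℝ) * q = n * p := by exact_mod_cast heq
    rcases h0 with h0 | h0
    · have : (p : ℝ) ≠ 0 := by exact_mod_cast h0
      exact hcomb (m / p) (by field_simp) (by field_simp; linarith)
    · have : (q : ℝ) ≠ 0 := by exact_mod_cast h0
      exact hcomb (n / q) (by field_simp; linarith) (by field_simp)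

end Lattice

lemma deriv_eq_zero_of_exp_eq {α : ℂ → ℂ} (hα : Differentiable ℂ α) {c : ℂ}
    (h : ∀ z, exp (α z) = c) (z : ℂ) : deriv α z = 0 := by
  have h1 := (hα z).hasDerivAt.cexp.unique
    ((hasDerivAt_const z c).congr_of_eventuallyEq (.of_forall h))
  exact (mul_eq_zero.1 h1).resolve_left (exp_ne_zero _)

section Sharing

variable {f α β : ℂ → ℂ} {a b : ℂ}

/-- The exponential identity obtained by eliminating `f` from the two sharing relations. -/
lemma exp_identity_of_sharing (hf : Differentiable ℂ f) (hα : Differentiable ℂ α)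
    (hβ : Differentiable ℂ β) (hfα : ∀ z, deriv f z - a = exp (α z) * (f z - a))
    (hfβ : ∀ z, deriv f z - b = exp (β z) * (f z - b)) (z : ℂ) :
    (b - a) * (exp (α z) - exp (β z)) * (exp (α z) * exp (β z)) -
      b * exp (α z) ^ 2 - a * exp (β z) ^ 2 - (b - a) * deriv α z * exp (α z) +
      (b - a) * deriv β z * exp (β z) +
      ((b - a) * (deriv α z - deriv β z) + a + b) * (exp (α z) * exp (β z)) = 0 := by
  have h1 : ∀ z, f z * (exp (α z) - exp (β z)) = (b - a) + a * exp (α z) - b * exp (β z) :=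
    fun z ↦ by linear_combination hfβ z - hfα z
  have hu := (hα z).hasDerivAt.cexp
  have hv := (hβ z).hasDerivAt.cexp
  have h2 := ((hf z).hasDerivAt.fun_mul (hu.fun_sub hv)).unique
    ((((hu.const_mul a).const_add (b - a)).fun_sub (hv.const_mul b)).congr_of_eventuallyEq
      (.of_forall h1))
  have h3 := hfα z
  have h4 := h1 z
  linear_combination (-(exp (α z) - exp (β z))) * h2 + (exp (α z) - exp (β z)) ^ 2 * h3 +
    (exp (α z) * deriv α z - exp (β z) * deriv β z + (exp (α z) - exp (β z)) * exp (α z)) * h4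

/-- Two entire functions `α`, `β`, not both constant, for which `f` and `f'` satisfy the sharing
relations with factors `exp α` and `exp β` fulfil one of three trivial relations. -/
lemma exp_relations_of_sharing (hf : Differentiable ℂ f) (hα : Differentiable ℂ α)
    (hβ : Differentiable ℂ β) (hfα : ∀ z, deriv f z - a = exp (α z) * (f z - a))
    (hfβ : ∀ z, deriv f z - b = exp (β z) * (f z - b)) (hab : a ≠ b)
    {w : ℂ} (hw : deriv α w ≠ 0 ∨ deriv β w ≠ 0) :
    (∀ z, exp (α z) = exp (β z)) ∨ (∀ z, exp (α z) = 1) ∨ ∀ z, exp (β z) = 1 := by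
  classical
  obtain ⟨F, hne, hF, hA, hp, hq⟩ := exists_filter_isSmall_deriv hα hβ hw
  set A := meanAbsRe α + meanAbsRe β with hAdef
  have hba : b - a ≠ 0 := sub_ne_zero.2 hab.symm
  let L : ℤ → ℤ → Prop := fun m n ↦ meanAbsRe (fun z ↦ m * α z + n * β z) =o[F] A
  have hL : ∀ p q : ℤ, L p q → p ≠ 0 ∨ q ≠ 0 → ∀ m n : ℤ, L m n ↔ m * q = n * p :=
    fun p q h h0 m n ↦ isLittleO_iff_mul_eq_mul hα.continuous hβ.continuous hA h h0 m n
  let e : Fin 7 → ℤ × ℤ := ![(1, 0), (0, 1), (1, -1), (-1, 1), (0, -1), (-1, 0), (0, 0)]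
  let g : Fin 7 → ℂ → ℂ := ![fun _ ↦ b - a, fun _ ↦ -(b - a), fun _ ↦ -b, fun _ ↦ -a,
    (fun _ ↦ -(b - a)) * deriv α, (fun _ ↦ b - a) * deriv β,
    (fun _ ↦ b - a) * (deriv α - deriv β) + fun _ ↦ a + b]
  let h : Fin 7 → ℂ → ℂ := fun i z ↦ (e i).1 * α z + (e i).2 * β z
  have hh : ∀ i, Differentiable ℂ (h i) := fun i ↦ (hα.const_mul _).add (hβ.const_mul _)
  have hd : ∀ i, IsSmall A F (deriv (h i)) := fun i ↦ by
    have : deriv (h i) = (fun _ ↦ ((e i).1 : ℂ)) * deriv α + (fun _ ↦ ((e i).2 : ℂ)) * deriv β :=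
      funext fun z ↦
        (((hα z).hasDerivAt.const_mul _).fun_add ((hβ z).hasDerivAt.const_mul _)).deriv
    rw [this]
    exact ((isSmall_const hA _).mul hA hp).add hA ((isSmall_const hA _).mul hA hq)
  have hg : ∀ i, IsSmall A F (g i) := by
    have hc := isSmall_const (F := F) (A := A) hA
    simp only [g, Fin.forall_fin_succ, Matrix.cons_val_zero, Matrix.cons_val_succ]
    exact ⟨hc _, hc _, hc _, hc _, (hc _).mul hA hp, (hc _).mul hA hq,
      ((hc _).mul hA (hp.sub hA hq)).add hA (hc _), fun i ↦ i.elim0⟩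
  have hsum : ∀ z, ∑ i, g i z * exp (h i z) = 0 := fun z ↦ by
    have := exp_identity_of_sharing hf hα hβ hfα hfβ z
    simp [Fin.sum_univ_succ, g, h, e, exp_add, exp_neg]
    field_simp
    linear_combination this
  have hrow : ∀ i z, ∑ j, (if L ((e j).1 - (e i).1) ((e j).2 - (e i).2) then
      g j z * exp (h j z - h i z) else 0) = 0 := fun i z ↦ by
    have hLe : ∀ j, L ((e j).1 - (e i).1) ((e j).2 - (e i).2) ↔
        meanAbsRe (h j - h i) =o[F] A := fun j ↦ by
      simp only [L]
      rw [show (fun z ↦ _) = h j - h i from funext fun z ↦ by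
        simp only [h, Pi.sub_apply]
        push_cast
        ring]
    simpa only [hLe] using sum_equivalent_mul_exp_eq_zero hF hA hh hd hg hsum i z
  by_cases h1 : L 1 (-1)
  · left
    intro z
    have r := hrow 0 z
    simp [Fin.sum_univ_succ, e, g, h, hL _ _ h1 (by norm_num)] at r
    rw [exp_sub] at r
    field_simp at r
    exact mul_left_cancel₀ hba (by linear_combination r)
  right
  by_cases h2 : L 0 1
  · right
    have r1 := hrow 0
    have r2 := hrow 5
    simp [Fin.sum_univ_succ, e, g, h, hL _ _ h2 (by norm_num)] at r1 r2
    have hv : ∀ z, (b - a) * exp (β z) = b := fun z ↦ by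
      have := r1 z
      rw [exp_neg] at this
      field_simp at this
      linear_combination this
    have hq0 := deriv_eq_zero_of_exp_eq hβ (c := b / (b - a)) fun z ↦ by
      rw [eq_div_iff hba, mul_comm, hv]
    have ha : a = 0 := by simpa [hq0] using r2 0
    subst ha
    rw [sub_zero] at hv hba
    exact fun z ↦ mul_left_cancel₀ hba ((hv z).trans (mul_one b).symm)
  by_cases h3 : L 1 0
  · left
    have r1 := hrow 1
    have r2 := hrow 4
    simp [Fin.sum_univ_succ, e, g, h, hL _ _ h3 (by norm_num)] at r1 r2
    have hu : ∀ z, (b - a) * exp (α z) = -a := fun z ↦ by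
      have := r1 z
      rw [exp_neg] at this
      field_simp at this
      linear_combination -this
    have hp0 := deriv_eq_zero_of_exp_eq hα (c := -a / (b - a)) fun z ↦ by
      rw [eq_div_iff hba, mul_comm, hu]
    have hb : b = 0 := by simpa [hp0] using r2 0
    subst hb
    rw [zero_sub] at hu hba
    exact fun z ↦ mul_left_cancel₀ hba ((hu z).trans (mul_one (-a)).symm)
  exfalso
  by_cases h4 : L 1 1
  · have r1 := hrow 0
    have r2 := hrow 1
    simp [Fin.sum_univ_succ, e, g, h, hL _ _ h4 (by norm_num)] at r1 r2
    have hpq : ∀ z, deriv α z = deriv β z := fun z ↦ by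
      have e1 := r1 z
      have e2 := r2 z
      rw [show -β z - α z = -α z - β z by ring] at e1
      refine mul_left_cancel₀ (mul_ne_zero hba (exp_ne_zero (-α z - β z))) ?_
      linear_combination -e1 - e2
    refine h1 ?_
    have hconst : ∀ z, α z - β z = α 0 - β 0 := fun z ↦ is_const_of_deriv_eq_zero (hα.sub hβ)
      (fun z ↦ by rw [deriv_sub (hα z) (hβ z), hpq, sub_self]) z 0
    have hmean : meanAbsRe (fun z ↦ (1 : ℤ) * α z + (-1 : ℤ) * β z) =
        fun _ ↦ |(α 0 - β 0).re| := funext fun r ↦ by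
      simp only [Int.cast_one, Int.cast_neg, one_mul, neg_one_mul, ← sub_eq_add_neg, hconst]
      exact Real.circleAverage_const _ _ _
    simp only [L, hmean]
    exact isLittleO_const_of_tendsto_atTop hA _
  by_cases h5 : L 2 (-1)
  · have r1 := hrow 1
    simp [Fin.sum_univ_succ, e, g, h, hL _ _ h5 (by norm_num)] at r1
    exact hab (sub_eq_zero.1 r1)
  have hN : ∀ p q : ℤ, ¬ L p q → ∀ m n : ℤ, m ≠ 0 ∨ n ≠ 0 → p * n = q * m → ¬ L m n :=
    fun p q hpq m n h0 heq hmn ↦ hpq ((hL m n hmn h0 p q).2 heq)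
  have h00 : L 0 0 := by
    simp only [L, Int.cast_zero, zero_mul, add_zero]
    rw [show meanAbsRe (fun _ ↦ 0) = fun _ ↦ 0 from funext fun r ↦ by
      simp [meanAbsRe, Real.circleAverage_const]]
    exact isLittleO_zero _ _
  have r := hrow 0 0
  simp [Fin.sum_univ_succ, e, g, h, h00, hN _ _ h1 (-1) 1, hN _ _ h2 0 (-1), hN _ _ h3 (-1) 0,
    hN _ _ h3 (-2) 0, hN _ _ h4 (-1) (-1), hN _ _ h5 (-2) 1] at r
  exact hba r

end Sharing

end RubelYang

/-- Rubel–Yang (paper's Theorem 2.A): a nonconstant entire function sharing two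
distinct finite values CM with its derivative equals its derivative. -/
theorem rubel_yang
    (f : ℂ → ℂ) (hf : Differentiable ℂ f) (hnc : ¬∃ c : ℂ, ∀ z, f z = c)
    (a b : ℂ) (hab : a ≠ b)
    (ha : ∃ φ : ℂ → ℂ, Differentiable ℂ φ ∧ (∀ z, φ z ≠ 0) ∧
      ∀ z, deriv f z - a = φ z * (f z - a))
    (hb : ∃ φ : ℂ → ℂ, Differentiable ℂ φ ∧ (∀ z, φ z ≠ 0) ∧
      ∀ z, deriv f z - b = φ z * (f z - b)) :
    ∀ z, deriv f z = f z := by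
  obtain ⟨φ, hφ, hφ0, hfφ⟩ := ha
  obtain ⟨ψ, hψ, hψ0, hfψ⟩ := hb
  obtain ⟨α, hα, hφα⟩ := exists_eq_exp hφ hφ0
  obtain ⟨β, hβ, hψβ⟩ := exists_eq_exp hψ hψ0
  simp only [hφα] at hfφ
  simp only [hψβ] at hfψ
  have hba : b - a ≠ 0 := sub_ne_zero.2 hab.symm
  have heq : ∀ z, Complex.exp (α z) = Complex.exp (β z) → deriv f z = f z := fun z hz ↦ by
    have h1 := hfφ z
    have h2 := hfψ z
    rw [← hz] at h2
    have h3 : Complex.exp (α z) = 1 := mul_right_cancel₀ hba (by linear_combination h2 - h1)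
    linear_combination h1 + (f z - a) * h3
  by_cases hw : ∃ w, deriv α w ≠ 0 ∨ deriv β w ≠ 0
  · obtain ⟨w, hw⟩ := hw
    rcases exp_relations_of_sharing hf hα hβ hfφ hfψ hab hw with h | h | h
    · exact fun z ↦ heq z (h z)
    · exact fun z ↦ by linear_combination hfφ z + (f z - a) * h z
    · exact fun z ↦ by linear_combination hfψ z + (f z - b) * h z
  · push Not at hw
    have hα0 : ∀ z, α z = α 0 := fun z ↦ is_const_of_deriv_eq_zero hα (fun w ↦ (hw w).1) z 0
    have hβ0 : ∀ z, β z = β 0 := fun z ↦ is_const_of_deriv_eq_zero hβ (fun w ↦ (hw w).2) z 0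
    by_cases h0 : Complex.exp (α 0) = Complex.exp (β 0)
    · exact fun z ↦ heq z (by rw [hα0, hβ0, h0])
    · refine absurd ⟨(b - a + a * Complex.exp (α 0) - b * Complex.exp (β 0)) /
        (Complex.exp (α 0) - Complex.exp (β 0)), fun z ↦ ?_⟩ hnc
      have h1 := hfφ z
      have h2 := hfψ z
      rw [hα0] at h1
      rw [hβ0] at h2
      rw [eq_div_iff (sub_ne_zero.2 h0)]
      linear_combination h2 - h1
end
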